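/- arXiv:1804.04895 — 3 statements merged into one kernel-verified Lean document; each statement's English description precedes it below -/
import Mathlib

section
/- Let K ⊂ ℝⁿ be a convex body (a compact convex set with non-empty interior), let E ⊂ K be a measurable subset with 0 < |E| < |K|, and let P ∈ ℂ[X₁,...,X_n] be a complex polynomial function of degree d. Then sup_{x ∈ K} |P(x)| ≤ 2^{2d+1} · ((1 + (1 − |E|/|K|)^{1/n}) / (1 − (1 − |E|/|K|)^{1/n}))^d · sup_{x ∈ E} |P(x)|. -/
open MeasureTheory

lemma rz_fact (d : ℕ) (hd : 1 ≤ d) : ((d:ℝ)+1)^d / (d.factorial : ℝ) ≤ 2 * 4^d := by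
  obtain ⟨k, rfl⟩ : ∃ k, d = k + 1 := ⟨d - 1, by omega⟩
  have h := Real.pow_div_factorial_le_exp (((k+1 : ℕ):ℝ)+1) (by positivity) (k+1)
  refine h.trans ?_
  have e1 : Real.exp (((k+1 : ℕ):ℝ)+1) = (Real.exp 1)^(k+2) := by
    rw [← Real.exp_nat_mul]; congr 1; push_cast; ring
  rw [e1]
  have h1 : Real.exp 1 ≤ 2.7183 := by linarith [Real.exp_one_lt_d9]
  calc (Real.exp 1)^(k+2) = (Real.exp 1)^k * (Real.exp 1)^2 := by ring
    _ ≤ 4^k * 2.7183^2 := by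
        gcongr
        linarith
    _ ≤ 2 * 4^(k+1) := by
        have : (0:ℝ) < 4^k := by positivity
        rw [pow_succ (4:ℝ) k]; norm_num; linarith

lemma rz_prod_dist (d k : ℕ) (hk : k ≤ d) :
    ∏ j ∈ (Finset.range (d+1)).erase k, |(k:ℝ) - j| = (k.factorial : ℝ) * ((d-k).factorial : ℝ) := by
  obtain ⟨e, rfl⟩ : ∃ e, d = k + e := ⟨d - k, by omega⟩
  have h1 : ∏ j ∈ (Finset.range (k+e+1)).erase k, |(k:ℝ) - j|
      = ∏ j ∈ (Finset.range (k+e+1)).erase k, (if j = k then 1 else |(k:ℝ) - j|) := by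
    apply Finset.prod_congr rfl
    intro j hj
    rw [if_neg (Finset.ne_of_mem_erase hj)]
  rw [h1, Finset.prod_erase _ (by simp), show k + e + 1 = k + 1 + e by ring,
    Finset.prod_range_add, Finset.prod_range_succ]
  have h2 : ∏ x ∈ Finset.range k, (if x = k then 1 else |(k:ℝ) - x|) = (k.factorial : ℝ) := by
    rw [← Finset.prod_range_reflect, ← Finset.prod_range_add_one_eq_factorial, Nat.cast_prod]
    apply Finset.prod_congr rfl
    intro j hj
    have hj' := Finset.mem_range.1 hj
    rw [if_neg (by omega), Nat.sub_sub, Nat.cast_sub (by omega)]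
    push_cast
    rw [abs_of_nonneg (by linarith [Nat.cast_nonneg (α := ℝ) j])]
    ring
  have h3 : ∏ x ∈ Finset.range e, (if k + 1 + x = k then 1 else |(k:ℝ) - (k + 1 + x : ℕ)|)
      = (e.factorial : ℝ) := by
    rw [← Finset.prod_range_add_one_eq_factorial, Nat.cast_prod]
    apply Finset.prod_congr rfl
    intro j hj
    rw [if_neg (by omega)]
    push_cast
    rw [abs_of_nonpos (by linarith [Nat.cast_nonneg (α := ℝ) j])]
    ring
  rw [h2, h3]
  simp

lemma rz_amgm (d k : ℕ) (hd : 1 ≤ d) (hk : k ≤ d) (y : ℝ) (hy : 0 ≤ y) :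
    ∏ j ∈ (Finset.range (d+1)).erase k, (y + j) ≤ (y + ((d:ℝ)+1)/2)^d := by
  set s := (Finset.range (d+1)).erase k with hs
  have hc : s.card = d := by
    rw [hs, Finset.card_erase_of_mem (by simp; omega)]; simp
  have hd0 : (0:ℝ) < d := by exact_mod_cast hd
  have h := Real.geom_mean_le_arith_mean s (fun _ => (1:ℝ)) (fun j => y + j)
    (fun _ _ => zero_le_one) (by simp [hc]; omega) (fun _ _ => by positivity)
  simp only [Real.rpow_one, one_mul, Finset.sum_const, hc, nsmul_eq_mul, mul_one] at h
  have hp : 0 ≤ ∏ j ∈ s, (y + j) := Finset.prod_nonneg (fun _ _ => by positivity)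
  have h4 : ∑ j ∈ s, (y + (j:ℝ)) ≤ d * (y + ((d:ℝ)+1)/2) := by
    rw [Finset.sum_add_distrib, Finset.sum_const, hc, nsmul_eq_mul]
    have : ∑ j ∈ s, (j:ℝ) ≤ ∑ j ∈ Finset.range (d+1), (j:ℝ) :=
      Finset.sum_le_sum_of_subset_of_nonneg (Finset.erase_subset _ _) (fun _ _ _ => by positivity)
    have h5 : ∑ j ∈ Finset.range (d+1), (j:ℝ) = d * ((d:ℝ)+1)/2 := by
      have := Finset.sum_range_id_mul_two (d+1)
      rw [Nat.add_sub_cancel] at this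
      have h6 : (∑ j ∈ Finset.range (d+1), (j:ℝ)) * 2 = (d+1) * d := by
        have h7 := congrArg (Nat.cast (R := ℝ)) this
        push_cast at h7
        exact h7
      linarith
    rw [h5] at this
    linarith
  have h5 : (∏ j ∈ s, (y + (j:ℝ))) ^ ((d:ℝ)⁻¹) ≤ y + ((d:ℝ)+1)/2 := by
    refine h.trans ?_
    rw [div_le_iff₀ hd0]; linarith
  calc ∏ j ∈ s, (y + (j:ℝ)) = ((∏ j ∈ s, (y + (j:ℝ))) ^ ((d:ℝ)⁻¹))^d := by
        rw [Real.rpow_inv_natCast_pow hp (by omega)]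
    _ ≤ _ := by gcongr

lemma rz_sum (d : ℕ) : ∑ k ∈ Finset.range (d+1), (((k.factorial : ℝ) * ((d-k).factorial : ℝ)))⁻¹
    = 2^d / (d.factorial : ℝ) := by
  rw [eq_div_iff (by positivity), Finset.sum_mul]
  have := Nat.sum_range_choose d
  have h : (∑ k ∈ Finset.range (d+1), (d.choose k : ℝ)) = 2^d := by exact_mod_cast this
  rw [← h]
  apply Finset.sum_congr rfl
  intro k hk
  rw [Nat.cast_choose ℝ (by simp at hk; omega)]
  field_simp

/-- Lagrange estimate with well separated nodes. -/
lemma rz_lagrange (q : Polynomial ℂ) (d : ℕ) (hd : 1 ≤ d) (hq : q.natDegree ≤ d)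
    (x : ℕ → ℝ) (h y M : ℝ) (hh : 0 < h) (hy : 0 ≤ y)
    (hx0 : ∀ j ≤ d, 0 ≤ x j) (hx1 : ∀ j ≤ d, x j ≤ h * (y + j))
    (hsep : ∀ i ≤ d, ∀ j ≤ d, h * |(i:ℝ) - j| ≤ |x i - x j|)
    (hM : ∀ j ≤ d, ‖q.eval ((x j : ℝ) : ℂ)‖ ≤ M) :
    ‖q.eval 0‖ ≤ 2 * 4^d * (1 + 2 * y / d)^d * M := by
  have hM0 : 0 ≤ M := (norm_nonneg _).trans (hM 0 (by omega))
  have hd0 : (0:ℝ) < d := by exact_mod_cast hd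
  have hinj : Set.InjOn (fun j => ((x j : ℝ) : ℂ)) (Finset.range (d+1) : Set ℕ) := by
    intro i hi j hj hij
    simp only [Finset.coe_range, Set.mem_Iio] at hi hj
    have e : x i = x j := Complex.ofReal_injective hij
    have := hsep i (by omega) j (by omega)
    rw [e, sub_self, abs_zero] at this
    have h2 : |(i:ℝ) - j| = 0 := le_antisymm (by
      by_contra hcon; push Not at hcon
      nlinarith) (abs_nonneg _)
    have := sub_eq_zero.1 (abs_eq_zero.1 h2)
    exact_mod_cast this
  have hdeg : q.degree < (Finset.range (d+1)).card := by
    rw [Finset.card_range]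
    exact (Polynomial.degree_le_of_natDegree_le hq).trans_lt (by exact_mod_cast Nat.lt_succ_self d)
  have hint := Lagrange.eq_interpolate hinj hdeg
  have hev : q.eval 0 = ∑ k ∈ Finset.range (d+1), q.eval ((x k : ℝ):ℂ) *
      ∏ j ∈ (Finset.range (d+1)).erase k, (((x k:ℝ):ℂ) - (x j : ℝ))⁻¹ * (0 - ((x j:ℝ):ℂ)) := by
    conv_lhs => rw [hint]
    rw [Lagrange.interpolate_apply, Polynomial.eval_finsetSum]
    apply Finset.sum_congr rfl
    intro k hk
    rw [Polynomial.eval_mul, Polynomial.eval_C, Lagrange.basis, Polynomial.eval_prod]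
    congr 1
    apply Finset.prod_congr rfl
    intro j hj
    simp [Lagrange.basisDivisor]
  have hterm : ∀ k ∈ Finset.range (d+1), ‖q.eval ((x k : ℝ):ℂ) *
      ∏ j ∈ (Finset.range (d+1)).erase k, (((x k:ℝ):ℂ) - (x j : ℝ))⁻¹ * (0 - ((x j:ℝ):ℂ))‖
      ≤ M * ((y + ((d:ℝ)+1)/2)^d * (((k.factorial : ℝ) * ((d-k).factorial : ℝ)))⁻¹) := by
    intro k hk
    have hk' : k ≤ d := by simp at hk; omega
    rw [norm_mul]
    refine mul_le_mul (hM k hk') ?_ (norm_nonneg _) hM0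
    rw [norm_prod]
    calc _ ≤ ∏ j ∈ (Finset.range (d+1)).erase k, ((y + j) * |(k:ℝ) - j|⁻¹) := by
          apply Finset.prod_le_prod (fun _ _ => norm_nonneg _)
          intro j hj
          have hjk := Finset.ne_of_mem_erase hj
          have hj' : j ≤ d := by have := Finset.mem_of_mem_erase hj; simp at this; omega
          have hpos : 0 < |(k:ℝ) - j| := abs_pos.2 (sub_ne_zero.2 (by exact_mod_cast hjk.symm))
          rw [norm_mul, norm_inv, zero_sub, norm_neg, ← Complex.ofReal_sub, Complex.norm_real,
            Complex.norm_real, Real.norm_eq_abs, Real.norm_eq_abs, abs_of_nonneg (hx0 j hj')]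
          have h1 := hsep k hk' j hj'
          have h2 : 0 < |x k - x j| := lt_of_lt_of_le (by positivity) h1
          rw [inv_mul_eq_div, ← div_eq_mul_inv, div_le_div_iff₀ h2 hpos]
          calc x j * |(k:ℝ) - j| ≤ (h * (y + j)) * |(k:ℝ) - j| := by
                gcongr; exact hx1 j hj'
            _ = (y + j) * (h * |(k:ℝ) - j|) := by ring
            _ ≤ _ := by gcongr
      _ = (∏ j ∈ (Finset.range (d+1)).erase k, (y + (j:ℝ))) *
            (((k.factorial : ℝ) * ((d-k).factorial : ℝ)))⁻¹ := by
          rw [Finset.prod_mul_distrib, Finset.prod_inv_distrib, rz_prod_dist d k hk']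
      _ ≤ _ := by
          gcongr
          exact rz_amgm d k hd hk' y hy
  rw [hev]
  refine (norm_sum_le _ _).trans ((Finset.sum_le_sum hterm).trans ?_)
  rw [← Finset.mul_sum, ← Finset.mul_sum, rz_sum, mul_comm M]
  refine mul_le_mul_of_nonneg_right ?_ hM0
  have h1 : y + ((d:ℝ)+1)/2 ≤ ((d:ℝ)+1)/2 * (1 + 2 * y / d) := by
    have : y ≤ ((d:ℝ)+1)/2 * (2*y/d) := by
      rw [div_mul_div_comm, le_div_iff₀ (by positivity)]; nlinarith
    linarith
  calc (y + ((d:ℝ)+1)/2)^d * (2^d / (d.factorial:ℝ))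
      ≤ (((d:ℝ)+1)/2 * (1 + 2 * y / d))^d * (2^d / (d.factorial:ℝ)) := by gcongr
    _ = (((d:ℝ)+1)^d / (d.factorial : ℝ)) * (1 + 2 * y / d)^d := by
        rw [mul_pow, div_pow]; field_simp
    _ ≤ _ := by
        gcongr
        exact rz_fact d hd

lemma rz_cdf_diff (F : Set ℝ) (hF : IsCompact F) (a b : ℝ) (hab : a ≤ b) :
    volume.real (F ∩ Set.Iic b) ≤ volume.real (F ∩ Set.Iic a) + (b - a) := by
  have hsub : F ∩ Set.Iic b ⊆ (F ∩ Set.Iic a) ∪ Set.Ioc a b := by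
    rintro x ⟨hx, hxb⟩
    rcases le_or_gt x a with h | h
    · exact Or.inl ⟨hx, h⟩
    · exact Or.inr ⟨h, hxb⟩
  have hfin : volume (F ∩ Set.Iic a) ≠ ⊤ :=
    ne_top_of_le_ne_top hF.measure_lt_top.ne (measure_mono Set.inter_subset_left)
  calc volume.real (F ∩ Set.Iic b) ≤ volume.real ((F ∩ Set.Iic a) ∪ Set.Ioc a b) := by
        refine measureReal_mono hsub ?_
        exact (measure_union_lt_top hfin.lt_top (by simp)).ne
    _ ≤ volume.real (F ∩ Set.Iic a) + volume.real (Set.Ioc a b) := measureReal_union_le _ _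
    _ = _ := by rw [Real.volume_real_Ioc_of_le hab]

lemma rz_cdf_mono (F : Set ℝ) (hF : IsCompact F) (a b : ℝ) (hab : a ≤ b) :
    volume.real (F ∩ Set.Iic a) ≤ volume.real (F ∩ Set.Iic b) := by
  refine measureReal_mono (Set.inter_subset_inter_right _ (Set.Iic_subset_Iic.2 hab)) ?_
  exact ne_top_of_le_ne_top hF.measure_lt_top.ne (measure_mono Set.inter_subset_left)

lemma rz_node (F : Set ℝ) (hF : IsCompact F) (hne : F.Nonempty) (c : ℝ) (hc0 : 0 ≤ c)
    (hc : c ≤ volume.real F) : ∃ z ∈ F, volume.real (F ∩ Set.Iic z) = c := by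
  obtain ⟨a, haF, ha⟩ := hF.exists_isLeast hne
  obtain ⟨b, hbF, hb⟩ := hF.exists_isGreatest hne
  have hab : a ≤ b := ha hbF
  have hcont : Continuous (fun x => volume.real (F ∩ Set.Iic x)) := by
    apply LipschitzWith.continuous (K := 1)
    apply LipschitzWith.of_le_add_mul
    intro x y
    rw [NNReal.coe_one, one_mul, Real.dist_eq]
    rcases le_total x y with h | h
    · linarith [rz_cdf_mono F hF x y h, abs_nonneg (x - y)]
    · linarith [rz_cdf_diff F hF y x h, le_abs_self (x - y)]
  have hfa : volume.real (F ∩ Set.Iic a) = 0 := by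
    have : F ∩ Set.Iic a ⊆ {a} := fun x hx => le_antisymm hx.2 (ha hx.1)
    have h2 : volume (F ∩ Set.Iic a) = 0 := measure_mono_null this (by simp)
    simp [Measure.real, h2]
  have hfb : volume.real (F ∩ Set.Iic b) = volume.real F := by
    have : F ⊆ Set.Iic b := fun x hx => hb hx
    rw [Set.inter_eq_left.2 this]
  have hmem : c ∈ Set.Icc (volume.real (F ∩ Set.Iic a)) (volume.real (F ∩ Set.Iic b)) := by
    rw [hfa, hfb]; exact ⟨hc0, hc⟩
  obtain ⟨w, ⟨haw, hwb⟩, hw⟩ := intermediate_value_Icc hab hcont.continuousOn hmem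
  obtain ⟨z, ⟨hzF, hzw⟩, hz⟩ := (hF.inter_right (isClosed_Iic (a := w))).exists_isGreatest
    ⟨a, haF, haw⟩
  refine ⟨z, hzF, ?_⟩
  rw [← hw]
  congr 1
  ext x
  exact ⟨fun hx => ⟨hx.1, Set.mem_Iic.2 (le_trans (Set.mem_Iic.1 hx.2) hzw)⟩, fun hx => ⟨hx.1, hz hx⟩⟩

/-- One-dimensional Remez inequality at an endpoint. -/
lemma rz_one_dim (q : Polynomial ℂ) (d : ℕ) (hq : q.natDegree ≤ d) (A : Set ℝ) (L s M : ℝ)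
    (hL : 0 < L) (hs : 0 < s) (hs1 : s ≤ 1) (hA : A ⊆ Set.Icc 0 L)
    (hAv : ENNReal.ofReal (s * L) ≤ volume A)
    (hM : ∀ r ∈ A, ‖q.eval ((r : ℝ) : ℂ)‖ ≤ M) :
    ‖q.eval 0‖ ≤ 2 * 4^d * ((2 - s) / s)^d * M := by
  have hsL : 0 < s * L := by positivity
  have hAne : A.Nonempty := by
    by_contra hcon
    rw [Set.not_nonempty_iff_eq_empty] at hcon
    rw [hcon, measure_empty, nonpos_iff_eq_zero, ENNReal.ofReal_eq_zero] at hAv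
    linarith
  have hM0 : 0 ≤ M := by
    obtain ⟨r, hr⟩ := hAne
    exact (norm_nonneg _).trans (hM r hr)
  rcases Nat.eq_zero_or_pos d with rfl | hd
  · obtain ⟨r, hr⟩ := hAne
    have h1 := hM r hr
    rw [Polynomial.eq_C_of_natDegree_le_zero hq] at h1 ⊢
    simp only [Polynomial.eval_C] at h1 ⊢
    simp only [pow_zero, mul_one]
    linarith
  set F : Set ℝ := Set.Icc 0 L ∩ {r | ‖q.eval ((r : ℝ) : ℂ)‖ ≤ M} with hFdef
  have hFc : IsCompact F := by
    apply isCompact_Icc.inter_right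
    apply isClosed_le _ continuous_const
    exact (q.continuous.comp Complex.continuous_ofReal).norm
  have hAF : A ⊆ F := fun r hr => ⟨hA hr, hM r hr⟩
  have hFne : F.Nonempty := hAne.mono hAF
  have hFv : s * L ≤ volume.real F := by
    have := hAv.trans (measure_mono hAF)
    exact (ENNReal.ofReal_le_iff_le_toReal hFc.measure_lt_top.ne).1 this
  have hd0 : (0:ℝ) < d := by exact_mod_cast hd
  set h := s * L / d with hh
  have hhpos : 0 < h := by positivity
  have hex : ∀ j : ℕ, ∃ z, j ≤ d → z ∈ F ∧ volume.real (F ∩ Set.Iic z) = j * h := by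
    intro j
    by_cases hj : j ≤ d
    · obtain ⟨z, hz, hz'⟩ := rz_node F hFc hFne (j * h) (by positivity) (by
        refine le_trans ?_ hFv
        have : (j:ℝ) ≤ d := by exact_mod_cast hj
        calc j * h ≤ d * h := by gcongr
          _ = s * L := by rw [hh]; field_simp)
      exact ⟨z, fun _ => ⟨hz, hz'⟩⟩
    · exact ⟨0, fun h => absurd h hj⟩
  choose x hx using hex
  have hsL' : s * L = d * h := by rw [hh]; field_simp
  have key := rz_lagrange q d hd hq x h (d * (1 - s) / s) M hhpos
    (by have : 0 ≤ 1 - s := by linarith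
        positivity)
    (fun j hj => (hx j hj).1.1.1)
    (fun j hj => by
      have h1 := (hx j hj).2
      have h2 := rz_cdf_diff F hFc (x j) L (hx j hj).1.1.2
      have h0 : F ⊆ Set.Iic L := fun r hr => hr.1.2
      rw [Set.inter_eq_left.2 h0, h1] at h2
      have h3 : h * (d * (1 - s) / s + j) = L - s * L + j * h := by
        rw [hh]; field_simp
      rw [h3]; linarith)
    (fun i hi j hj => by
      have h1 := (hx i hi).2
      have h2 := (hx j hj).2
      have h3 : h * |(i:ℝ) - j| = |i * h - j * h| := by
        rw [← sub_mul, abs_mul, abs_of_pos hhpos, mul_comm]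
      rw [h3, ← h1, ← h2]
      rcases le_total (x i) (x j) with hle | hle
      · have a1 := rz_cdf_mono F hFc _ _ hle
        have a2 := rz_cdf_diff F hFc _ _ hle
        rw [abs_of_nonpos (by linarith), abs_of_nonpos (by linarith)]
        linarith
      · have a1 := rz_cdf_mono F hFc _ _ hle
        have a2 := rz_cdf_diff F hFc _ _ hle
        rw [abs_of_nonneg (by linarith), abs_of_nonneg (by linarith)]
        linarith)
    (fun j hj => (hx j hj).1.2)
  have e : 1 + 2 * (d * (1 - s) / s) / d = (2 - s) / s := by
    field_simp; ring
  rwa [e] at key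

lemma rz_pow_le (N : ℕ) (a : ℝ) (S : Set (Set.Ioi (0:ℝ))) (hS : MeasurableSet S)
    (h : ∀ r ∈ S, r.1 ≤ a) :
    Measure.volumeIoiPow N S ≤ ENNReal.ofReal (a^N) * (Measure.comap Subtype.val volume) S := by
  rw [Measure.volumeIoiPow, withDensity_apply _ hS, ← setLIntegral_const]
  apply setLIntegral_mono' hS
  intro r hr
  apply ENNReal.ofReal_le_ofReal
  exact pow_le_pow_left₀ (le_of_lt r.2) (h r hr) N

lemma rz_pow_ge (N : ℕ) (a : ℝ) (ha : 0 ≤ a) (S : Set (Set.Ioi (0:ℝ))) (hS : MeasurableSet S)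
    (h : ∀ r ∈ S, a ≤ r.1) :
    ENNReal.ofReal (a^N) * (Measure.comap Subtype.val volume) S ≤ Measure.volumeIoiPow N S := by
  rw [Measure.volumeIoiPow, withDensity_apply _ hS, ← setLIntegral_const]
  apply setLIntegral_mono' hS
  intro r hr
  apply ENNReal.ofReal_le_ofReal
  exact pow_le_pow_left₀ ha (h r hr) N

lemma rz_bathtub (N : ℕ) (ρ : Set.Ioi (0:ℝ)) (s : ℝ) (hs : 0 < s) (hs1 : s < 1)
    (A : Set (Set.Ioi (0:ℝ))) (hA : MeasurableSet A) (hAρ : ∀ r ∈ A, r ≤ ρ)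
    (hAv : (Measure.comap Subtype.val volume) A ≤ ENNReal.ofReal (s * ρ.1)) :
    Measure.volumeIoiPow N A ≤
      ENNReal.ofReal (1 - (1 - s)^(N+1)) * Measure.volumeIoiPow N (Set.Iio ρ) := by
  have hρ : 0 < ρ.1 := ρ.2
  have ha0 : 0 < (1 - s) * ρ.1 := mul_pos (by linarith) hρ
  set a : Set.Ioi (0:ℝ) := ⟨(1 - s) * ρ.1, ha0⟩ with ha
  have haρ : a ≤ ρ := by
    rw [← Subtype.coe_le_coe]; simp only [ha]; nlinarith
  set ν : Measure (Set.Ioi (0:ℝ)) := Measure.comap Subtype.val volume with hν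
  set μ := Measure.volumeIoiPow N with hμ
  set B : Set (Set.Ioi (0:ℝ)) := Set.Icc a ρ with hB
  have hBm : MeasurableSet B := measurableSet_Icc
  have hνapp : ∀ S : Set (Set.Ioi (0:ℝ)), ν S = volume (Subtype.val '' S) := fun S =>
    comap_subtype_coe_apply measurableSet_Ioi volume S
  have hνB : ν B = ENNReal.ofReal (s * ρ.1) := by
    have : Subtype.val '' B = Set.Icc a.1 ρ.1 := by
      ext x
      constructor
      · rintro ⟨y, hy, rfl⟩
        exact ⟨hy.1, hy.2⟩
      · intro hx
        exact ⟨⟨x, lt_of_lt_of_le ha0 hx.1⟩, ⟨hx.1, hx.2⟩, rfl⟩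
    rw [hνapp, this, Real.volume_Icc]
    congr 1
    simp only [ha]; ring
  have hfin : ν (A ∩ B) ≠ ⊤ := by
    refine ne_top_of_le_ne_top ?_ (measure_mono Set.inter_subset_right)
    rw [hνB]; exact ENNReal.ofReal_ne_top
  have hdiff : ν (A \ B) ≤ ν (B \ A) := by
    have h1 := measure_inter_add_sdiff (μ := ν) A hBm
    have h2 := measure_inter_add_sdiff (μ := ν) B hA
    rw [Set.inter_comm] at h2
    have : ν (A ∩ B) + ν (A \ B) ≤ ν (A ∩ B) + ν (B \ A) := by
      rw [h1, h2, hνB]; exact hAv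
    exact (ENNReal.add_le_add_iff_left hfin).1 this
  have hμAB : μ A ≤ μ B := by
    have h1 := measure_inter_add_sdiff (μ := μ) A hBm
    have h2 := measure_inter_add_sdiff (μ := μ) B hA
    rw [Set.inter_comm] at h2
    rw [← h1, ← h2]
    refine add_le_add le_rfl ?_
    calc μ (A \ B) ≤ ENNReal.ofReal (a.1^N) * ν (A \ B) := by
          apply rz_pow_le N a.1 _ (hA.diff hBm)
          intro r hr
          by_contra hcon
          push Not at hcon
          exact hr.2 ⟨le_of_lt hcon, hAρ r hr.1⟩
      _ ≤ ENNReal.ofReal (a.1^N) * ν (B \ A) := by gcongr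
      _ ≤ μ (B \ A) := rz_pow_ge N a.1 ha0.le _ (hBm.diff hA) (fun r hr => hr.1.1)
  have hμρ : μ {ρ} = 0 := by
    have h1 : ν {ρ} = 0 := by rw [hνapp]; simp
    exact (withDensity_absolutelyContinuous ν _) h1
  have hμB : μ B ≤ μ (Set.Ico a ρ) := by
    have : B ⊆ Set.Ico a ρ ∪ {ρ} := by
      intro r hr
      rcases lt_or_eq_of_le hr.2 with h | h
      · exact Or.inl ⟨hr.1, h⟩
      · exact Or.inr h
    calc μ B ≤ μ (Set.Ico a ρ ∪ {ρ}) := measure_mono this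
      _ ≤ μ (Set.Ico a ρ) + μ {ρ} := measure_union_le _ _
      _ = _ := by rw [hμρ, add_zero]
  refine hμAB.trans (hμB.trans ?_)
  have hsum : μ (Set.Iio a) + μ (Set.Ico a ρ) = μ (Set.Iio ρ) := by
    rw [← measure_union _ measurableSet_Ico, Set.Iio_union_Ico_eq_Iio haρ]
    rw [Set.disjoint_left]
    intro x hx hx'
    exact absurd hx'.1 (not_le.2 hx)
  have hq : (1 - s)^(N+1) ≤ 1 := pow_le_one₀ (by linarith) (by linarith)
  have e1 := Measure.volumeIoiPow_apply_Iio N a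
  have e2 := Measure.volumeIoiPow_apply_Iio N ρ
  have hne : μ (Set.Iio a) ≠ ⊤ := by rw [e1]; exact ENNReal.ofReal_ne_top
  rw [← ENNReal.add_le_add_iff_left hne, hsum, e1, e2, ← ENNReal.ofReal_mul (by linarith),
    ← ENNReal.ofReal_add (by positivity) (mul_nonneg (by linarith) (by positivity))]
  apply ENNReal.ofReal_le_ofReal
  apply le_of_eq
  simp only [ha, mul_pow]
  ring

lemma rz_polar (n : ℕ) (x0 : EuclideanSpace ℝ (Fin n))
    (S : Set (EuclideanSpace ℝ (Fin n))) (hn : 1 ≤ n) (hS : MeasurableSet S) :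
    volume S = ∫⁻ u : Metric.sphere (0 : EuclideanSpace ℝ (Fin n)) 1,
      Measure.volumeIoiPow (n - 1) {r : Set.Ioi (0:ℝ) | x0 + r.1 • u.1 ∈ S}
        ∂((volume : Measure (EuclideanSpace ℝ (Fin n))).toSphere) := by
  have : Nonempty (Fin n) := ⟨⟨0, hn⟩⟩
  have : Nontrivial (EuclideanSpace ℝ (Fin n)) := by infer_instance
  have hmp := (volume : Measure (EuclideanSpace ℝ (Fin n))).measurePreserving_homeomorphUnitSphereProd
  set Φ := homeomorphUnitSphereProd (EuclideanSpace ℝ (Fin n))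
  set S' : Set (EuclideanSpace ℝ (Fin n)) := (fun x => x0 + x) ⁻¹' S with hS'
  have hS'm : MeasurableSet S' := (measurable_const_add x0) hS
  have h1 : volume S = volume S' := (measure_preimage_add volume x0 S).symm
  have h2 : volume S' = (Measure.comap Subtype.val volume :
      Measure ({0}ᶜ : Set (EuclideanSpace ℝ (Fin n)))) (Subtype.val ⁻¹' S') := by
    rw [comap_subtype_coe_apply (measurableSet_singleton _).compl, Subtype.image_preimage_coe,
      Set.inter_comm, ← Set.sdiff_eq, measure_sdiff_null (measure_singleton _)]
  have hT : MeasurableSet (Φ.symm ⁻¹' (Subtype.val ⁻¹' S')) :=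
    Φ.symm.measurable (measurable_subtype_coe hS'm)
  have h3 := hmp.measure_preimage hT.nullMeasurableSet
  have h4 : Φ ⁻¹' (Φ.symm ⁻¹' (Subtype.val ⁻¹' S')) = Subtype.val ⁻¹' S' := by
    ext x; simp
  rw [h4] at h3
  rw [h1, h2, h3, Measure.prod_apply hT]
  simp only [finrank_euclideanSpace, Fintype.card_fin]
  rfl

lemma rz_ray (n : ℕ) (hn : 1 ≤ n) (K E : Set (EuclideanSpace ℝ (Fin n)))
    (hKcomp : IsCompact K) (hKconv : Convex ℝ K) (hE : MeasurableSet E) (hEK : E ⊆ K)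
    (x0 : EuclideanSpace ℝ (Fin n)) (hx0 : x0 ∈ K) (s : ℝ) (hs : 0 < s) (hs1 : s < 1)
    (hv : ENNReal.ofReal (1 - (1 - s)^n) * volume K < volume E) :
    ∃ (u : EuclideanSpace ℝ (Fin n)) (ρ : ℝ) (A : Set ℝ), 0 < ρ ∧ A ⊆ Set.Icc 0 ρ ∧
      ENNReal.ofReal (s * ρ) ≤ volume A ∧ ∀ r ∈ A, x0 + r • u ∈ E := by
  by_contra hcon
  push Not at hcon
  apply absurd hv
  rw [not_lt, rz_polar n x0 E hn hE, rz_polar n x0 K hn hKcomp.measurableSet,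
    ← lintegral_const_mul' _ _ ENNReal.ofReal_ne_top]
  apply lintegral_mono
  intro u
  have hu : ‖u.1‖ = 1 := by simp
  set Ku : Set (Set.Ioi (0:ℝ)) := {r | x0 + r.1 • u.1 ∈ K} with hKu
  set Eu : Set (Set.Ioi (0:ℝ)) := {r | x0 + r.1 • u.1 ∈ E} with hEu
  have hEKu : Eu ⊆ Ku := fun r hr => hEK hr
  have hcont : Continuous (fun r : Set.Ioi (0:ℝ) => x0 + r.1 • u.1) := by fun_prop
  have hEum : MeasurableSet Eu := hcont.measurable hE
  rcases Set.eq_empty_or_nonempty Ku with hemp | hne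
  · have : Eu = ∅ := Set.subset_empty_iff.1 (hemp ▸ hEKu)
    show Measure.volumeIoiPow (n-1) Eu ≤ _
    rw [this]; simp
  have hbdd : BddAbove (Subtype.val '' Ku) := by
    obtain ⟨R, hR⟩ := hKcomp.isBounded.exists_norm_le
    refine ⟨R + ‖x0‖, ?_⟩
    rintro _ ⟨r, hr, rfl⟩
    have h1 := hR _ hr
    have h2 : ‖r.1 • u.1‖ = r.1 := by
      rw [norm_smul, hu, mul_one, Real.norm_eq_abs, abs_of_pos r.2]
    have h3 : ‖r.1 • u.1‖ ≤ ‖x0 + r.1 • u.1‖ + ‖x0‖ := by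
      have := norm_sub_le (x0 + r.1 • u.1) x0
      simpa using this
    linarith
  set ρ := sSup (Subtype.val '' Ku) with hρ
  have hle : ∀ r ∈ Ku, r.1 ≤ ρ := fun r hr => le_csSup hbdd ⟨r, hr, rfl⟩
  have hρ0 : 0 < ρ := by
    obtain ⟨r, hr⟩ := hne
    exact lt_of_lt_of_le r.2 (hle r hr)
  have hsub : Set.Iio (⟨ρ, hρ0⟩ : Set.Ioi (0:ℝ)) ⊆ Ku := by
    intro r hr
    have hr' : r.1 < ρ := hr
    obtain ⟨_, ⟨t, ht, rfl⟩, hrt⟩ := exists_lt_of_lt_csSup (hne.image _) hr'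
    have ht0 : 0 < t.1 := t.2
    have hr0 : 0 < r.1 := r.2
    have := hKconv.add_smul_sub_mem hx0 ht
      (t := r.1 / t.1) ⟨by positivity, by rw [div_le_one ht0]; exact hrt.le⟩
    rw [add_sub_cancel_left, smul_smul, div_mul_cancel₀ _ ht0.ne'] at this
    exact this
  by_cases hcase : ENNReal.ofReal (s * ρ) ≤ volume (Subtype.val '' Eu)
  · obtain ⟨r, ⟨t, ht, rfl⟩, hr'⟩ := hcon u.1 ρ (Subtype.val '' Eu) hρ0 (by
      rintro _ ⟨r, hr, rfl⟩
      exact ⟨le_of_lt r.2, hle r (hEKu hr)⟩) hcase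
    exact absurd ht hr'
  · push Not at hcase
    have h := rz_bathtub (n-1) ⟨ρ, hρ0⟩ s hs hs1 Eu hEum (fun r hr => hle r (hEKu hr)) (by
      rw [comap_subtype_coe_apply measurableSet_Ioi]
      exact hcase.le)
    rw [Nat.sub_add_cancel hn] at h
    exact h.trans (mul_le_mul_right (measure_mono hsub) _)

lemma rz_point (n : ℕ) (hn : 1 ≤ n) (K E : Set (EuclideanSpace ℝ (Fin n)))
    (hKcomp : IsCompact K) (hKconv : Convex ℝ K) (hE : MeasurableSet E) (hEK : E ⊆ K)
    (x0 : EuclideanSpace ℝ (Fin n)) (hx0 : x0 ∈ K) (s : ℝ) (hs : 0 < s) (hs1 : s < 1)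
    (hv : ENNReal.ofReal (1 - (1 - s)^n) * volume K < volume E)
    (P : MvPolynomial (Fin n) ℂ) (d : ℕ) (hd : P.totalDegree = d) (M : ℝ)
    (hM : ∀ x ∈ E, ‖MvPolynomial.eval (fun j => ((x j : ℝ) : ℂ)) P‖ ≤ M) :
    ‖MvPolynomial.eval (fun j => ((x0 j : ℝ) : ℂ)) P‖ ≤ 2 * 4^d * ((2 - s) / s)^d * M := by
  obtain ⟨u, ρ, A, hρ, hA, hAv, hAE⟩ := rz_ray n hn K E hKcomp hKconv hE hEK x0 hx0 s hs hs1 hv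
  set f : Fin n → Polynomial ℂ := fun j =>
    Polynomial.C ((x0 j : ℝ) : ℂ) + Polynomial.C ((u j : ℝ) : ℂ) * Polynomial.X with hf
  set q : Polynomial ℂ := MvPolynomial.aeval f P with hq
  have hqd : q.natDegree ≤ d := by
    have := MvPolynomial.aeval_natDegree_le (m := d) (n := 1) P hd.le f (fun i => by
      rw [hf]
      exact (Polynomial.natDegree_add_le _ _).trans
        (max_le (by simp) ((Polynomial.natDegree_C_mul_le _ _).trans Polynomial.natDegree_X_le)))
    simpa using this
  have hev : ∀ z : ℂ, q.eval z
      = MvPolynomial.eval (fun j => ((x0 j : ℝ) : ℂ) + ((u j : ℝ) : ℂ) * z) P := by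
    intro z
    rw [hq, ← Polynomial.coe_evalRingHom, MvPolynomial.aeval_def, MvPolynomial.hom_eval₂,
      MvPolynomial.eval, MvPolynomial.coe_eval₂Hom]
    congr 1
    · ext <;> simp
    · ext j; simp [hf]
  have key := rz_one_dim q d hqd A ρ s M hρ hs hs1.le hA hAv (fun r hr => by
    rw [hev]
    have := hM _ (hAE r hr)
    convert this using 4
    simp [mul_comm])
  rw [hev] at key
  simpa using key

/-- **Multi-dimensional Remez inequality for complex polynomials.** Let `K ⊂ ℝⁿ` be a
convex body, `E ⊆ K` measurable with `0 < |E| < |K|`, and `P` a complex polynomial of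
degree `d`. Then
`sup_K |P| ≤ 2^{2d+1} ((1+(1-|E|/|K|)^{1/n})/(1-(1-|E|/|K|)^{1/n}))^d sup_E |P|`. -/
theorem remez_inequality_complex (n : ℕ) (hn : 1 ≤ n)
    (K E : Set (EuclideanSpace ℝ (Fin n)))
    (hKcomp : IsCompact K) (hKconv : Convex ℝ K) (hKint : (interior K).Nonempty)
    (hE : MeasurableSet E) (hEK : E ⊆ K)
    (hE0 : 0 < volume E) (hEK' : volume E < volume K)
    (P : MvPolynomial (Fin n) ℂ) (d : ℕ) (hd : P.totalDegree = d) :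
    (⨆ x ∈ K, ‖MvPolynomial.eval (fun j => ((x j : ℝ) : ℂ)) P‖) ≤
      2 ^ (2 * d + 1) *
        ((1 + (1 - (volume E).toReal / (volume K).toReal) ^ ((1 : ℝ) / n)) /
          (1 - (1 - (volume E).toReal / (volume K).toReal) ^ ((1 : ℝ) / n))) ^ d *
        ⨆ x ∈ E, ‖MvPolynomial.eval (fun j => ((x j : ℝ) : ℂ)) P‖ := by
  have hK0 : 0 < volume K := hE0.trans hEK'
  have hKfin : volume K ≠ ⊤ := hKcomp.measure_lt_top.ne
  have hEfin : volume E ≠ ⊤ := ne_top_of_lt hEK'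
  have hKr : 0 < (volume K).toReal := ENNReal.toReal_pos hK0.ne' hKfin
  have hEr : 0 < (volume E).toReal := ENNReal.toReal_pos hE0.ne' hEfin
  have hEKr : (volume E).toReal < (volume K).toReal := (ENNReal.toReal_lt_toReal hEfin hKfin).2 hEK'
  set l := (volume E).toReal / (volume K).toReal with hl
  have hl0 : 0 < l := by positivity
  have hl1 : l < 1 := (div_lt_one hKr).2 hEKr
  set t := (1 - l) ^ ((1:ℝ) / n) with ht
  have hn0 : n ≠ 0 := by omega
  have hnr : (0:ℝ) < n := by exact_mod_cast hn
  have ht0 : 0 < t := Real.rpow_pos_of_pos (by linarith) _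
  have ht1 : t < 1 := Real.rpow_lt_one (by linarith) (by linarith) (by positivity)
  have htn : t ^ n = 1 - l := by
    rw [ht, one_div, Real.rpow_inv_natCast_pow (by linarith) hn0]
  set f : EuclideanSpace ℝ (Fin n) → ℝ :=
    fun x => ‖MvPolynomial.eval (fun j => ((x j : ℝ) : ℂ)) P‖ with hf
  have hfc : Continuous f := by
    apply Continuous.norm
    exact (MvPolynomial.continuous_eval P).comp (by fun_prop)
  obtain ⟨C, hC⟩ := hKcomp.exists_bound_of_continuousOn hfc.continuousOn
  have hf0 : ∀ x, 0 ≤ f x := fun x => norm_nonneg _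
  have hC' : ∀ x ∈ K, f x ≤ C := fun x hx => (le_abs_self _).trans (hC x hx)
  obtain ⟨z, hz⟩ := hKint
  have hC0 : 0 ≤ C := (hf0 z).trans (hC' z (interior_subset hz))
  set M := ⨆ x ∈ E, f x with hMdef
  have hbdd : BddAbove (Set.range (fun x => ⨆ (_ : x ∈ E), f x)) := by
    refine ⟨C, ?_⟩
    rintro _ ⟨x, rfl⟩
    exact Real.iSup_le (fun hx => hC' x (hEK hx)) hC0
  have hM : ∀ x ∈ E, f x ≤ M := by
    intro x hx
    refine le_ciSup_of_le hbdd x ?_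
    rw [ciSup_pos hx]
  have hM0 : 0 ≤ M := Real.iSup_nonneg (fun x => Real.iSup_nonneg (fun _ => hf0 x))
  have hpt : ∀ x ∈ K, f x ≤ 2 ^ (2 * d + 1) * ((1 + t) / (1 - t)) ^ d * M := by
    intro x hx
    have hs : ∀ s ∈ Set.Ioo 0 (1 - t), f x ≤ 2 * 4^d * ((2 - s) / s)^d * M := by
      intro s hs
      have hs0 := hs.1
      have hs2 := hs.2
      have hlt : 1 - (1 - s)^n < l := by
        have : t ^ n < (1 - s)^n := pow_lt_pow_left₀ (by linarith) ht0.le hn0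
        linarith
      refine rz_point n hn K E hKcomp hKconv hE hEK x hx s hs.1 (by linarith) ?_ P d hd M hM
      rw [← ENNReal.ofReal_toReal hKfin, ← ENNReal.ofReal_toReal hEfin,
        ← ENNReal.ofReal_mul (by
          have : (1 - s)^n ≤ 1 := pow_le_one₀ (by linarith) (by linarith)
          linarith)]
      rw [ENNReal.ofReal_lt_ofReal_iff hEr]
      calc _ < l * (volume K).toReal := by gcongr
        _ = _ := by rw [hl]; field_simp
    have hlim : Filter.Tendsto (fun s : ℝ => 2 * 4^d * ((2 - s) / s)^d * M)
        (nhdsWithin (1 - t) (Set.Iio (1 - t))) (nhds (2 * 4^d * ((2 - (1 - t)) / (1 - t))^d * M)) := by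
      apply Filter.Tendsto.mono_left _ nhdsWithin_le_nhds
      have hne : 1 - t ≠ 0 := by linarith
      have : ContinuousAt (fun s : ℝ => 2 * 4^d * ((2 - s) / s)^d * M) (1 - t) := by
        fun_prop (disch := exact hne)
      exact this
    have hres := ge_of_tendsto hlim (by
      filter_upwards [Ioo_mem_nhdsLT (show (0:ℝ) < 1 - t by linarith)] with s hs'
      exact hs s hs')
    have e1 : (2:ℝ) ^ (2 * d + 1) = 2 * 4^d := by
      rw [pow_succ, pow_mul]; norm_num; ring
    have e2 : 2 - (1 - t) = 1 + t := by ring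
    rw [e1]
    rw [e2] at hres
    exact hres
  have hR0 : 0 ≤ 2 ^ (2 * d + 1) * ((1 + t) / (1 - t)) ^ d * M := by
    have : 0 < 1 - t := by linarith
    positivity
  exact Real.iSup_le (fun x => Real.iSup_le (fun hx => hpt x hx) hR0) hR0
end

section
/- Let n ≥ 1, R > 0, let P ∈ ℂ[X₁,...,X_n] be a non-zero complex polynomial function of degree d, and let F(t) = (1 + (1−t)^{1/n}) / (1 − (1−t)^{1/n}) for 0 < t ≤ 1. Then for every 0 < ε ≤ |B(0,R)|, the sublevel set E_ε = { x ∈ B(0,R) : |P(x)| ≤ 2^{−2d−1} · F(ε/|B(0,R)|)^{−d} · sup_{B(0,R)} |P| } has Lebesgue measure |E_ε| ≤ ε, where B(0,R) is the open Euclidean ball in ℝⁿ centered at 0 of radius R. -/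
open MeasureTheory

lemma aux_pow_fact (d : ℕ) : ((d : ℝ) + 1) ^ d ≤ 4 ^ d * (d.factorial : ℝ) := by
  induction d with
  | zero => simp
  | succ k ih =>
    have hk : (0 : ℝ) < (k : ℝ) + 1 := by positivity
    have h1 : (1 + 1 / ((k : ℝ) + 1)) ^ (k + 1) ≤ 4 := by
      have h2 : 1 + 1 / ((k : ℝ) + 1) ≤ Real.exp (1 / ((k : ℝ) + 1)) := by
        rw [add_comm]; exact Real.add_one_le_exp _
      calc (1 + 1 / ((k : ℝ) + 1)) ^ (k + 1) ≤ Real.exp (1 / ((k : ℝ) + 1)) ^ (k + 1) := by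
            gcongr
        _ = Real.exp 1 := by
            rw [← Real.exp_nat_mul]
            congr 1
            push_cast
            field_simp
        _ ≤ 4 := by linarith [Real.exp_one_lt_d9]
    have h3 : ((k : ℝ) + 1 + 1) = (1 + 1 / ((k : ℝ) + 1)) * (k + 1) := by field_simp
    push_cast [Nat.factorial_succ]
    rw [h3, mul_pow, pow_succ ((k : ℝ) + 1), pow_succ (4 : ℝ)]
    have h4 : (0:ℝ) ≤ ((k:ℝ)+1)^k * (k+1) := by positivity
    calc _ ≤ 4 * (((k:ℝ)+1)^k * (k+1)) := by gcongr
      _ ≤ 4 * ((4 ^ k * (k.factorial : ℝ)) * (k+1)) := by gcongr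
      _ = _ := by ring

lemma aux_prod_amgm (d : ℕ) (a : ℝ) (ha : 0 ≤ a) :
    ∏ j ∈ Finset.range d, (a + (j + 1 : ℕ)) ≤ (a + (d + 1) / 2) ^ d := by
  have h1 : (∏ j ∈ Finset.range d, (a + (j + 1 : ℕ))) ^ 2 ≤ ((a + ((d : ℝ) + 1) / 2) ^ d) ^ 2 := by
    rw [sq]
    nth_rewrite 1 [← Finset.prod_range_reflect]
    rw [← Finset.prod_mul_distrib, ← pow_mul, mul_comm d 2, pow_mul]
    calc _ ≤ ∏ j ∈ Finset.range d, (a + ((d : ℝ) + 1) / 2) ^ 2 := by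
          apply Finset.prod_le_prod
          · intro i _; positivity
          · intro i hi
            have hi' : i < d := Finset.mem_range.1 hi
            have : ((d - 1 - i + 1 : ℕ) : ℝ) = (d : ℝ) - i := by
              rw [show d - 1 - i + 1 = d - i by omega, Nat.cast_sub hi'.le]
            rw [this]; push_cast
            nlinarith [sq_nonneg ((d : ℝ) - i - (i + 1))]
      _ = _ := by simp
  exact le_of_sq_le_sq h1 (by positivity)

lemma aux_prod_abs (i d : ℕ) (h : i ≤ d) :
    ∏ j ∈ (Finset.range (d + 1)).erase i, |(i : ℝ) - j| = (i.factorial : ℝ) * (d - i).factorial := by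
  induction d, h using Nat.le_induction with
  | base =>
    rw [Finset.range_add_one, Finset.erase_insert (by simp), ← Finset.prod_range_reflect,
      ← Finset.prod_range_add_one_eq_factorial]
    push_cast
    simp only [Nat.sub_self, Nat.factorial_zero, Nat.cast_one, mul_one]
    apply Finset.prod_congr rfl
    intro j hj
    have hj' : j < i := Finset.mem_range.1 hj
    rw [Nat.sub_sub, Nat.cast_sub (by omega)]
    push_cast
    rw [show (i : ℝ) - (i - (1 + j)) = j + 1 by ring, abs_of_pos (by positivity)]
  | succ d h ih =>
    rw [Finset.range_add_one, Finset.erase_insert_of_ne (by omega), Finset.prod_insert (by simp), ih,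
      show d + 1 - i = (d - i) + 1 by omega, Nat.factorial_succ]
    have : |(i : ℝ) - (d + 1 : ℕ)| = ((d - i + 1 : ℕ) : ℝ) := by
      have h' : (i : ℝ) ≤ d := by exact_mod_cast h
      rw [abs_of_nonpos (by push_cast; linarith)]
      push_cast [Nat.cast_sub h]; ring
    rw [this]; push_cast; ring

lemma aux_prod_le (i d : ℕ) (h : i ≤ d) (a : ℝ) (ha : 0 ≤ a) :
    ∏ j ∈ (Finset.range (d + 1)).erase i, (a + j) ≤ ∏ j ∈ Finset.range d, (a + (j + 1 : ℕ)) := by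
  rcases Nat.eq_zero_or_pos i with rfl | hi
  · apply le_of_eq
    rw [show (Finset.range (d+1)).erase 0 = (Finset.range d).image (· + 1) by
      ext x; simp; constructor
      · rintro ⟨h1, h2⟩; exact ⟨x - 1, by omega, by omega⟩
      · rintro ⟨y, h1, rfl⟩; omega]
    rw [Finset.prod_image (by intro x _ y _ h; simpa using h)]
  · have h0 : 0 ∈ (Finset.range (d + 1)).erase i := by simp; omega
    rw [← Finset.mul_prod_erase _ _ h0]
    have hi' : i - 1 ∈ Finset.range d := by simp; omega
    rw [← Finset.mul_prod_erase (Finset.range d) _ hi']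
    have e : ((Finset.range (d + 1)).erase i).erase 0 = ((Finset.range d).erase (i-1)).image (· + 1) := by
      ext x; simp; constructor
      · rintro ⟨h1, h2, h3⟩; exact ⟨x - 1, by omega, by omega⟩
      · rintro ⟨y, h1, rfl⟩; omega
    rw [e, Finset.prod_image (by intro x _ y _ h; simpa using h)]
    gcongr
    omega

lemma aux_sum (d : ℕ) : ∑ i ∈ Finset.range (d + 1), (1 : ℝ) / ((i.factorial : ℝ) * (d - i).factorial)
    = 2 ^ d / d.factorial := by
  have : (2 : ℝ) ^ d = ∑ i ∈ Finset.range (d + 1), (d.choose i : ℝ) := by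
    exact_mod_cast (Nat.sum_range_choose d).symm
  rw [this, Finset.sum_div]
  apply Finset.sum_congr rfl
  intro i hi
  have hi' : i ≤ d := by simpa [Nat.lt_succ_iff] using hi
  rw [Nat.cast_choose ℝ hi']
  have := Nat.factorial_ne_zero d
  field_simp

lemma aux_sep (h : ℝ) (hh : 0 ≤ h) (k : ℕ) : ∀ (S : Set ℝ), BddBelow S → 
    ENNReal.ofReal (k * h) < volume S →
    ∃ y : ℕ → ℝ, (∀ j ≤ k, y j ∈ S) ∧ (∀ i j, i ≤ j → j ≤ k → ((j : ℝ) - i) * h ≤ y j - y i) := by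
  induction k with
  | zero =>
    intro S _ hv
    have : S.Nonempty := by
      by_contra hS
      rw [Set.not_nonempty_iff_eq_empty] at hS
      simp [hS] at hv
    obtain ⟨x, hx⟩ := this
    refine ⟨fun _ => x, fun _ _ => hx, ?_⟩
    intro i j hij hj
    have : i = 0 := by omega
    have : j = 0 := by omega
    subst_vars; simp
  | succ k ih =>
    intro S hb hv
    obtain ⟨q, hq1, hq2⟩ := ENNReal.lt_iff_exists_nnreal_btwn.1 hv
    have hq : (k + 1) * h < (q : ℝ) := by
      rw [← ENNReal.ofReal_coe_nnreal] at hq1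
      have := (ENNReal.ofReal_lt_ofReal_iff'.1 hq1).1
      push_cast at this; exact this
    set δ : ℝ := q - (k + 1) * h with hδ
    have hδ0 : 0 < δ := by linarith
    have hne : S.Nonempty := by
      by_contra hS
      rw [Set.not_nonempty_iff_eq_empty] at hS
      simp [hS] at hv
    obtain ⟨x, hx, hxδ⟩ := Real.lt_sInf_add_pos hne hδ0
    have hcov : S ⊆ (S ∩ Set.Ici (x + h)) ∪ Set.Ico (sInf S) (x + h) := by
      intro z hz
      by_cases hzx : x + h ≤ z
      · exact Or.inl ⟨hz, hzx⟩
      · exact Or.inr ⟨csInf_le hb hz, not_le.1 hzx⟩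
    have hle : volume S ≤ volume (S ∩ Set.Ici (x + h)) + ENNReal.ofReal (x + h - sInf S) := by
      refine (measure_mono hcov).trans ((measure_union_le _ _).trans ?_)
      rw [Real.volume_Ico]
    have hS' : ENNReal.ofReal (k * h) < volume (S ∩ Set.Ici (x + h)) := by
      by_contra hcon
      push Not at hcon
      have h1 : volume S ≤ ENNReal.ofReal (k * h) + ENNReal.ofReal (x + h - sInf S) :=
        hle.trans (by gcongr)
      rw [← ENNReal.ofReal_add (by positivity) (by linarith [csInf_le hb hx])] at h1
      have h2 : volume S ≤ q := by
        refine h1.trans ?_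
        rw [← ENNReal.ofReal_coe_nnreal]
        apply ENNReal.ofReal_le_ofReal
        linarith
      exact absurd hq2 (not_lt.2 h2)
    obtain ⟨y, hy1, hy2⟩ := ih _ (hb.mono Set.inter_subset_left) hS'
    refine ⟨fun j => if j = 0 then x else y (j - 1), ?_, ?_⟩
    · intro j hj
      by_cases hj0 : j = 0
      · simp [hj0, hx]
      · simp only [hj0, if_false]
        exact (hy1 _ (by omega)).1
    · intro i j hij hj
      by_cases hj0 : j = 0
      · have : i = 0 := by omega
        subst_vars; simp
      · by_cases hi0 : i = 0
        · subst hi0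
          simp only [hj0, if_false, if_true]
          have h1 := hy2 0 (j-1) (by omega) (by omega)
          have h2 := (hy1 0 (by omega)).2
          simp only [Set.mem_Ici] at h2
          have h3 : ((j - 1 : ℕ) : ℝ) = j - 1 := by
            rw [Nat.cast_sub (by omega)]; simp
          rw [h3] at h1
          push_cast at *
          linarith
        · simp only [hj0, hi0, if_false]
          have h1 := hy2 (i-1) (j-1) (by omega) (by omega)
          rw [Nat.cast_sub (by omega), Nat.cast_sub (by omega)] at h1
          push_cast at h1
          linarith

lemma remez1 (p : Polynomial ℂ) (d : ℕ) (hd : p.natDegree ≤ d) (S : Set ℝ) (L l : ℝ)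
    (hS : S ⊆ Set.Ioo 0 L) (hl : 0 < l) (hl1 : l ≤ 1) (hL : 0 < L)
    (hm : ENNReal.ofReal (l * L) < volume S) (C : ℝ)
    (hC : ∀ x ∈ S, ‖p.eval (x : ℂ)‖ ≤ C) :
    ‖p.eval 0‖ ≤ (4 * ((2 - l) / l)) ^ d * C := by
  have hbdd : BddBelow S := ⟨0, fun x hx => (hS hx).1.le⟩
  rcases Nat.eq_zero_or_pos d with rfl | hd0
  · obtain ⟨y, hy, -⟩ := aux_sep 0 le_rfl 0 S hbdd (by simpa using lt_of_le_of_lt bot_le hm)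
    have := hC _ (hy 0 le_rfl)
    rw [Polynomial.eq_C_of_natDegree_le_zero hd] at this ⊢
    simpa using this
  have hdR : (0 : ℝ) < d := by exact_mod_cast hd0
  set h := l * L / d with hh
  have hh0 : 0 < h := by positivity
  obtain ⟨y, hy, hgap⟩ := aux_sep h hh0.le d S hbdd (by
    rwa [show (d : ℝ) * h = l * L by rw [hh]; field_simp])
  set a := d * (1 - l) / l with ha
  have ha0 : 0 ≤ a := by
    have : 0 ≤ 1 - l := by linarith
    positivity
  have hLa : L = h * (a + d) := by rw [hh, ha]; field_simp; ring
  have hylt : ∀ j ≤ d, y j ≤ h * (a + j) := by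
    intro j hj
    have h1 := hgap j d hj le_rfl
    have h2 := (hS (hy d le_rfl)).2
    nlinarith
  have hy0 : ∀ j ≤ d, 0 < y j := fun j hj => (hS (hy j hj)).1
  have habs : ∀ i ≤ d, ∀ j ≤ d, h * |(i : ℝ) - j| ≤ |y i - y j| := by
    intro i hi j hj
    rcases le_total i j with hij | hij
    · have h1 := hgap i j hij hj
      have : (i : ℝ) ≤ j := by exact_mod_cast hij
      rw [abs_of_nonpos (by linarith)]
      refine le_trans ?_ (neg_le_abs _)
      linarith
    · have h1 := hgap j i hij hi
      have : (j : ℝ) ≤ i := by exact_mod_cast hij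
      rw [abs_of_nonneg (by linarith)]
      refine le_trans ?_ (le_abs_self _)
      linarith
  have hC0 : 0 ≤ C := (norm_nonneg _).trans (hC _ (hy 0 (by omega)))
  have hinj : Set.InjOn (fun j : ℕ => ((y j : ℝ) : ℂ)) (Finset.range (d + 1)) := by
    intro i hi j hj hij
    have hi' : i ≤ d := by simpa [Nat.lt_succ_iff] using hi
    have hj' : j ≤ d := by simpa [Nat.lt_succ_iff] using hj
    have e : y i = y j := by simpa using hij
    have := habs i hi' j hj'
    rw [e, sub_self, abs_zero] at this
    have h2 : |(i : ℝ) - j| ≤ 0 := by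
      by_contra hcon
      push Not at hcon
      nlinarith [mul_pos hh0 hcon]
    have h3 := abs_nonpos_iff.1 h2
    exact_mod_cast sub_eq_zero.1 h3
  have hdeg : p.degree < (Finset.range (d + 1)).card := by
    rw [Finset.card_range]
    exact lt_of_le_of_lt (Polynomial.degree_le_of_natDegree_le hd) (by exact_mod_cast Nat.lt_succ_self d)
  have hp := Lagrange.eq_interpolate hinj hdeg
  set Q := ∏ j ∈ Finset.range d, (a + (j + 1 : ℕ)) with hQ
  have hterm : ∀ i ∈ Finset.range (d + 1),
      ‖(Lagrange.basis (Finset.range (d+1)) (fun j : ℕ => ((y j : ℝ) : ℂ)) i).eval 0‖ ≤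
      Q * (1 / ((i.factorial : ℝ) * (d - i).factorial)) := by
    intro i hi
    have hi' : i ≤ d := by simpa [Nat.lt_succ_iff] using hi
    rw [Lagrange.basis, Polynomial.eval_prod, norm_prod]
    calc _ ≤ ∏ j ∈ (Finset.range (d + 1)).erase i, ((a + j) / |(i : ℝ) - j|) := by
          apply Finset.prod_le_prod
          · intro j _; positivity
          · intro j hj
            have hj1 : j ≠ i := Finset.ne_of_mem_erase hj
            have hj' : j ≤ d := by simpa [Nat.lt_succ_iff] using Finset.mem_of_mem_erase hj
            have hpos : 0 < |(i : ℝ) - j| := by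
              apply abs_pos.2
              rw [sub_ne_zero]
              exact_mod_cast hj1.symm
            have e : ‖(Lagrange.basisDivisor ((y i : ℝ) : ℂ) ((y j : ℝ) : ℂ)).eval 0‖ = y j / |y i - y j| := by
              simp only [Lagrange.basisDivisor, Polynomial.eval_mul, Polynomial.eval_C,
                Polynomial.eval_sub, Polynomial.eval_X, zero_sub, norm_mul, norm_neg, norm_inv]
              rw [← Complex.ofReal_sub, Complex.norm_real, Complex.norm_real, Real.norm_eq_abs,
                Real.norm_eq_abs, abs_of_pos (hy0 j hj')]
              field_simp
            rw [e]
            calc y j / |y i - y j| ≤ (h * (a + j)) / (h * |(i : ℝ) - j|) := by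
                  have := hylt j hj'
                  have := habs i hi' j hj'
                  gcongr
              _ = _ := by field_simp
      _ = (∏ j ∈ (Finset.range (d + 1)).erase i, (a + j)) / ((i.factorial : ℝ) * (d - i).factorial) := by
          rw [Finset.prod_div_distrib, aux_prod_abs i d hi']
      _ ≤ _ := by
          rw [mul_one_div]
          have := aux_prod_le i d hi' a ha0
          gcongr
  have hQ0 : 0 ≤ Q := by positivity
  have hmain : ‖p.eval 0‖ ≤ C * (Q * (2 ^ d / d.factorial)) := by
    rw [hp, Lagrange.interpolate_apply, Polynomial.eval_finsetSum, ← aux_sum, Finset.mul_sum, Finset.mul_sum]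
    refine (norm_sum_le _ _).trans ?_
    apply Finset.sum_le_sum
    intro i hi
    have hi' : i ≤ d := by simpa [Nat.lt_succ_iff] using hi
    rw [Polynomial.eval_mul, norm_mul, Polynomial.eval_C]
    exact mul_le_mul (hC _ (hy i hi')) (hterm i hi) (norm_nonneg _) hC0
  refine hmain.trans ?_
  rw [mul_comm]
  apply mul_le_mul_of_nonneg_right _ hC0
  set F := (2 - l) / l with hF
  have hF1 : 1 ≤ F := by rw [hF, le_div_iff₀ hl]; linarith
  have hbase : a + ((d : ℝ) + 1) / 2 ≤ F * (d + 1) / 2 := by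
    have : a + (d : ℝ) / 2 = F * d / 2 := by rw [ha, hF]; field_simp; ring
    linarith
  calc Q * (2 ^ d / d.factorial) ≤ (F * (d + 1) / 2) ^ d * (2 ^ d / d.factorial) := by
        gcongr
        exact (aux_prod_amgm d a ha0).trans (by gcongr)
    _ = F ^ d * (((d : ℝ) + 1) ^ d / d.factorial) := by
        rw [div_pow, mul_pow]; field_simp
    _ ≤ F ^ d * 4 ^ d := by
        gcongr
        rw [div_le_iff₀ (by positivity)]
        exact aux_pow_fact d
    _ = _ := by rw [mul_pow, mul_comm]


lemma ray_bound (k : ℕ) (L l : ℝ) (hL : 0 < L) (hl : 0 < l) (hl1 : l ≤ 1) (S : Set (Set.Ioi (0:ℝ)))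
    (hSm : MeasurableSet S) (hS : S ⊆ Set.Iio ⟨L, hL⟩)
    (hm : (volume : Measure ℝ).comap Subtype.val S ≤ ENNReal.ofReal (l * L)) :
    Measure.volumeIoiPow k S ≤ ENNReal.ofReal (1 - (1 - l) ^ (k + 1)) *
      Measure.volumeIoiPow k (Set.Iio ⟨L, hL⟩) := by
  rcases hl1.eq_or_lt with rfl | hl1
  · simpa using measure_mono hS
  set c : ℝ := (1 - l) * L with hc
  have hc0 : 0 < c := mul_pos (by linarith) hL
  have hcL : c < L := by rw [hc]; nlinarith
  set κ : Measure (Set.Ioi (0:ℝ)) := (volume : Measure ℝ).comap Subtype.val with hκ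
  set ν := Measure.volumeIoiPow k with hν
  set I : Set (Set.Ioi (0:ℝ)) := Set.Ico ⟨c, hc0⟩ ⟨L, hL⟩ with hI
  have hIm : MeasurableSet I := measurableSet_Ico
  have hκI : κ I = ENNReal.ofReal (l * L) := by
    rw [hκ, comap_subtype_coe_apply measurableSet_Ioi]
    have : Subtype.val '' I = Set.Ico c L := by
      ext x
      simp only [hI, Set.mem_image, Set.mem_Ico, Subtype.exists, Set.mem_Ioi]
      constructor
      · rintro ⟨a, ha, ⟨h1, h2⟩, rfl⟩; exact ⟨h1, h2⟩
      · rintro ⟨h1, h2⟩; exact ⟨x, hc0.trans_le h1, ⟨h1, h2⟩, rfl⟩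
    rw [this, Real.volume_Ico]
    congr 1; rw [hc]; ring
  have hdiff : κ (S \ I) ≤ κ (I \ S) := by
    have h1 := measure_inter_add_sdiff (μ := κ) S hIm
    have h2 := measure_inter_add_sdiff (μ := κ) I hSm
    have h3 : κ S ≤ κ I := by rw [hκI]; exact hm
    rw [← h1, ← h2, Set.inter_comm I S] at h3
    refine (ENNReal.add_le_add_iff_left ?_).1 h3
    refine ne_top_of_le_ne_top ?_ (measure_mono (Set.inter_subset_right : S ∩ I ⊆ I))
    rw [hκI]; exact ENNReal.ofReal_ne_top
  have hνdiff : ν (S \ I) ≤ ν (I \ S) := by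
    rw [hν, Measure.volumeIoiPow, withDensity_apply _ (hSm.diff hIm), withDensity_apply _ (hIm.diff hSm)]
    calc _ ≤ ∫⁻ r in S \ I, ENNReal.ofReal (c ^ k) ∂κ := by
          apply setLIntegral_mono measurable_const
          rintro r ⟨hr1, hr2⟩
          apply ENNReal.ofReal_le_ofReal
          have : r.1 < c := by
            by_contra hcon
            exact hr2 ⟨not_lt.1 hcon, hS hr1⟩
          exact pow_le_pow_left₀ (le_of_lt r.2) this.le _
      _ = ENNReal.ofReal (c ^ k) * κ (S \ I) := by rw [setLIntegral_const]
      _ ≤ ENNReal.ofReal (c ^ k) * κ (I \ S) := by gcongr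
      _ = ∫⁻ r in I \ S, ENNReal.ofReal (c ^ k) ∂κ := by rw [setLIntegral_const]
      _ ≤ _ := by
          apply setLIntegral_mono
          · fun_prop
          rintro r ⟨hr1, hr2⟩
          apply ENNReal.ofReal_le_ofReal
          exact pow_le_pow_left₀ hc0.le hr1.1 _
  have hνS : ν S ≤ ν I := by
    rw [← measure_inter_add_sdiff (μ := ν) S hIm, ← measure_inter_add_sdiff (μ := ν) I hSm,
      Set.inter_comm I S]
    gcongr
  refine hνS.trans (le_of_eq ?_)
  have hIeq : I = Set.Iio ⟨L, hL⟩ \ Set.Iio ⟨c, hc0⟩ := by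
    ext x; simp [hI, and_comm]
  rw [hIeq, measure_sdiff, hν, Measure.volumeIoiPow_apply_Iio, Measure.volumeIoiPow_apply_Iio,
    ← ENNReal.ofReal_sub, ← ENNReal.ofReal_mul]
  · congr 1
    simp only [hc, mul_pow]; ring
  · have : (1 - l) ^ (k+1) ≤ 1 := pow_le_one₀ (by linarith) (by linarith)
    linarith
  · simp only; positivity
  · intro x hx; exact lt_trans (Set.mem_Iio.1 hx) hcL
  · exact measurableSet_Iio.nullMeasurableSet
  · rw [hν, Measure.volumeIoiPow_apply_Iio]; exact ENNReal.ofReal_ne_top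

lemma polar_apply {E : Type*} [NormedAddCommGroup E] [NormedSpace ℝ E] [MeasurableSpace E]
    [BorelSpace E] [FiniteDimensional ℝ E] [Nontrivial E] (μ : Measure E) [μ.IsAddHaarMeasure]
    (T : Set E) (hT : MeasurableSet T) :
    μ T = ∫⁻ θ : Metric.sphere (0:E) 1, Measure.volumeIoiPow (Module.finrank ℝ E - 1)
      {r | r.1 • θ.1 ∈ T} ∂μ.toSphere := by
  have hmp := μ.measurePreserving_homeomorphUnitSphereProd
  set W : Set (Metric.sphere (0:E) 1 × Set.Ioi (0:ℝ)) := {q | q.2.1 • q.1.1 ∈ T} with hW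
  have hWm : MeasurableSet W := by
    apply measurableSet_preimage _ hT
    fun_prop
  have h1 := hmp.measure_preimage hWm.nullMeasurableSet
  have h2 : (homeomorphUnitSphereProd E) ⁻¹' W = Subtype.val ⁻¹' T := by
    ext x
    have := congrArg Subtype.val ((homeomorphUnitSphereProd E).symm_apply_apply x)
    simp only [homeomorphUnitSphereProd_symm_apply_coe] at this
    simp only [hW, Set.mem_preimage, Set.mem_ofPred_eq, this]
  rw [h2, Measure.prod_apply hWm, comap_subtype_coe_apply (measurableSet_singleton _).compl,
    Subtype.image_preimage_coe] at h1
  rw [← measure_sdiff_null (s := T) (measure_singleton (μ := μ) 0)]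
  rw [show T \ {0} = {0}ᶜ ∩ T by ext; simp [and_comm]]
  exact h1

lemma polar_mono {E : Type*} [NormedAddCommGroup E] [NormedSpace ℝ E] [MeasurableSpace E]
    [BorelSpace E] [FiniteDimensional ℝ E] [Nontrivial E] (μ : Measure E) [μ.IsAddHaarMeasure]
    (T K : Set E) (hT : MeasurableSet T) (hK : MeasurableSet K) (c : ENNReal) (hc : c ≠ ⊤)
    (h : ∀ θ : Metric.sphere (0:E) 1, Measure.volumeIoiPow (Module.finrank ℝ E - 1)
      {r | r.1 • θ.1 ∈ T} ≤ c * Measure.volumeIoiPow (Module.finrank ℝ E - 1) {r | r.1 • θ.1 ∈ K}) :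
    μ T ≤ c * μ K := by
  rw [polar_apply μ T hT, polar_apply μ K hK, ← lintegral_const_mul' _ _ hc]
  exact lintegral_mono h

lemma ray_ball {E : Type*} [NormedAddCommGroup E] [InnerProductSpace ℝ E] (x θ : E) (hθ : ‖θ‖ = 1)
    (R : ℝ) (hR : 0 < R) (hx : ‖x‖ ≤ R) : ∃ L : ℝ, ∀ r : ℝ, 0 < r → (‖x + r • θ‖ < R ↔ r < L) := by
  set b : ℝ := inner ℝ x θ with hb
  set D := b ^ 2 + (R ^ 2 - ‖x‖ ^ 2) with hD
  refine ⟨-b + √D, fun r hr => ?_⟩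
  have h0 : 0 ≤ R ^ 2 - ‖x‖ ^ 2 := by nlinarith [norm_nonneg x]
  have h1 : ‖x + r • θ‖ ^ 2 = (r + b) ^ 2 - D + R ^ 2 := by
    rw [norm_add_sq_real, norm_smul, hθ, inner_smul_right, ← hb, hD, Real.norm_eq_abs, abs_of_pos hr]
    ring
  have h2 : ‖x + r • θ‖ < R ↔ (r + b) ^ 2 < D := by
    rw [← sq_lt_sq₀ (norm_nonneg _) hR.le, h1]
    constructor <;> intro h <;> linarith
  have h3 : |b| ≤ √D := Real.abs_le_sqrt (by linarith)
  rw [h2, Real.sq_lt (x := r + b)]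
  constructor
  · rintro ⟨_, h⟩; linarith
  · intro h; exact ⟨by linarith [neg_abs_le b], by linarith⟩

lemma poly_pos (n : ℕ) (R : ℝ) (hR : 0 < R) (P : MvPolynomial (Fin n) ℂ) (hP : P ≠ 0) :
    ∃ x ∈ Metric.closedBall (0 : EuclideanSpace ℝ (Fin n)) R,
      MvPolynomial.eval (fun j => ((x j : ℝ) : ℂ)) P ≠ 0 := by
  by_contra hcon
  push Not at hcon
  have hnh : (WithLp.toLp 2 : (Fin n → ℝ) → EuclideanSpace ℝ (Fin n)) ⁻¹' Metric.closedBall 0 R ∈ nhds 0 := by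
    have hcont : Continuous (WithLp.toLp 2 : (Fin n → ℝ) → EuclideanSpace ℝ (Fin n)) :=
      PiLp.continuous_toLp 2 _
    apply hcont.continuousAt.preimage_mem_nhds
    simpa using Metric.closedBall_mem_nhds (0 : EuclideanSpace ℝ (Fin n)) hR
  obtain ⟨δ, hδ, hsub⟩ := Metric.mem_nhds_iff.1 hnh
  apply hP
  apply MvPolynomial.funext_set (fun _ => (fun t : ℝ => (t : ℂ)) '' Set.Ioo (-δ) δ)
  · intro i
    exact (Set.Ioo_infinite (by linarith)).image Complex.ofReal_injective.injOn
  · intro x hx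
    choose y hy hyx using fun i => hx i (Set.mem_univ i)
    have hmem : y ∈ Metric.ball (0 : Fin n → ℝ) δ := by
      rw [mem_ball_zero_iff, pi_norm_lt_iff hδ]
      intro i
      rw [Real.norm_eq_abs, abs_lt]
      exact hy i
    have := hcon _ (hsub hmem)
    rw [map_zero, ← this]
    congr 2
    ext i
    exact (hyx i).symm


/-- **Measure of sublevel sets of polynomials on a ball.** Let `n ≥ 1`, `R > 0`, let `P`
be a non-zero complex polynomial of degree `d`, and let
`F(t) = (1+(1-t)^{1/n})/(1-(1-t)^{1/n})`. For every `0 < ε ≤ |B(0,R)|`, the set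
`E_ε = {x ∈ B(0,R) : |P(x)| ≤ 2^{-2d-1} F(ε/|B(0,R)|)^{-d} sup_{B(0,R)} |P|}`
has Lebesgue measure `|E_ε| ≤ ε`. -/
theorem sublevel_set_measure (n : ℕ) (hn : 1 ≤ n) (R : ℝ) (hR : 0 < R)
    (P : MvPolynomial (Fin n) ℂ) (hP : P ≠ 0) (d : ℕ) (hd : P.totalDegree = d)
    (M : ℝ) (hM : M = (volume (Metric.ball (0 : EuclideanSpace ℝ (Fin n)) R)).toReal)
    (ε : ℝ) (hε0 : 0 < ε) (hεM : ε ≤ M) :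
    volume {x ∈ Metric.ball (0 : EuclideanSpace ℝ (Fin n)) R |
        ‖MvPolynomial.eval (fun j => ((x j : ℝ) : ℂ)) P‖ ≤
          (2 : ℝ) ^ (-(2 * (d : ℤ)) - 1) *
            ((1 + (1 - ε / M) ^ ((1 : ℝ) / n)) /
              (1 - (1 - ε / M) ^ ((1 : ℝ) / n))) ^ (-(d : ℤ)) *
            ⨆ y ∈ Metric.ball (0 : EuclideanSpace ℝ (Fin n)) R,
              ‖MvPolynomial.eval (fun j => ((y j : ℝ) : ℂ)) P‖} ≤
      ENNReal.ofReal ε := by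
  subst hd
  set d := P.totalDegree with hd
  have : Nonempty (Fin n) := ⟨⟨0, hn⟩⟩
  set A : EuclideanSpace ℝ (Fin n) → ℝ :=
    fun x => ‖MvPolynomial.eval (fun j => ((x j : ℝ) : ℂ)) P‖ with hA
  have hAc : Continuous A := by
    apply Continuous.norm
    exact (MvPolynomial.continuous_eval P).comp (by fun_prop)
  obtain ⟨x0, hx0, hmax⟩ := (isCompact_closedBall (0 : EuclideanSpace ℝ (Fin n)) R).exists_isMaxOn
    ⟨0, by simp [hR.le]⟩ hAc.continuousOn
  have hA0 : 0 < A x0 := by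
    obtain ⟨x, hx, hne⟩ := poly_pos n R hR P hP
    exact lt_of_lt_of_le (norm_pos_iff.2 hne) (hmax hx)
  have hx0R : ‖x0‖ ≤ R := by simpa using hx0
  set s : ℝ := ⨆ y ∈ Metric.ball (0 : EuclideanSpace ℝ (Fin n)) R,
              ‖MvPolynomial.eval (fun j => ((y j : ℝ) : ℂ)) P‖ with hs
  have hsA : s ≤ A x0 := by
    apply Real.iSup_le _ hA0.le
    intro y
    apply Real.iSup_le _ hA0.le
    intro hy
    exact hmax (Metric.ball_subset_closedBall hy)
  have hM0 : 0 < M := hε0.trans_le hεM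
  set t := ε / M with ht
  have ht0 : 0 < t := by positivity
  have ht1 : t ≤ 1 := by rw [ht, div_le_one hM0]; exact hεM
  set u := (1 - t) ^ ((1 : ℝ) / n) with hu
  have hu0 : 0 ≤ u := Real.rpow_nonneg (by linarith) _
  have hnR : (0:ℝ) < n := by exact_mod_cast hn
  have hu1 : u < 1 := Real.rpow_lt_one (by linarith) (by linarith) (by positivity)
  have hun : u ^ n = 1 - t := by
    rw [hu, one_div, Real.rpow_inv_natCast_pow (by linarith) (by omega)]
  set F := (1 + u) / (1 - u) with hF
  have hF0 : 0 < F := div_pos (by linarith) (by linarith)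
  set c := (2 : ℝ) ^ (-(2 * (d : ℤ)) - 1) * F ^ (-(d : ℤ)) * s with hc
  have hcF : (4 * F) ^ d * c = s / 2 := by
    have h2 : (2 : ℝ) ^ (-(2 * (d : ℤ)) - 1) = (4 ^ d)⁻¹ * 2⁻¹ := by
      rw [zpow_sub₀ (by norm_num), zpow_neg, zpow_mul, zpow_natCast]
      norm_num
      ring
    rw [hc, h2, zpow_neg, zpow_natCast, mul_pow]
    field_simp
  set T : Set (EuclideanSpace ℝ (Fin n)) := {x ∈ Metric.ball 0 R | A x ≤ c} with hT
  have hTm : MeasurableSet T :=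
    measurableSet_ball.inter (measurableSet_le hAc.measurable measurable_const)
  have hkey : volume ((fun x => x0 + x) ⁻¹' T) ≤
      ENNReal.ofReal t * volume ((fun x => x0 + x) ⁻¹' Metric.ball (0 : EuclideanSpace ℝ (Fin n)) R) := by
    have hadd : Measurable (fun x : EuclideanSpace ℝ (Fin n) => x0 + x) := by fun_prop
    apply polar_mono _ _ _ (hadd hTm) (hadd measurableSet_ball) _ ENNReal.ofReal_ne_top
    intro θ
    have hθ : ‖θ.1‖ = 1 := by simpa using θ.2
    obtain ⟨L, hL⟩ := ray_ball x0 θ.1 hθ R hR hx0R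
    rw [finrank_euclideanSpace_fin]
    set S : Set (Set.Ioi (0:ℝ)) := {r | r.1 • θ.1 ∈ (fun x => x0 + x) ⁻¹' T} with hS
    have hSm : MeasurableSet S := by
      apply measurableSet_preimage _ (hadd hTm)
      fun_prop
    have hSL : ∀ r ∈ S, r.1 < L := by
      intro r hr
      have h1 : x0 + r.1 • θ.1 ∈ Metric.ball (0 : EuclideanSpace ℝ (Fin n)) R := hr.1
      exact (hL r.1 r.2).1 (by simpa using h1)
    rcases le_or_gt L 0 with hL0 | hL0
    · have : S = ∅ := by
        ext r
        simp only [Set.mem_empty_iff_false, iff_false]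
        intro hr
        have h1 := hSL r hr
        have h2 : 0 < r.1 := r.2
        linarith
      rw [this]; simp
    have hK : {r : Set.Ioi (0:ℝ) | r.1 • θ.1 ∈ (fun x => x0 + x) ⁻¹' Metric.ball (0 : EuclideanSpace ℝ (Fin n)) R}
        = Set.Iio ⟨L, hL0⟩ := by
      ext r
      have h1 := hL r.1 r.2
      simp only [Set.mem_ofPred_eq, Set.mem_preimage, mem_ball_zero_iff, Set.mem_Iio, h1]
      rfl
    rw [hK]
    have hte : t = 1 - (1 - (1 - u)) ^ (n - 1 + 1) := by
      rw [Nat.sub_add_cancel hn, sub_sub_cancel, hun]; ring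
    rw [hte]
    apply ray_bound (n - 1) L (1 - u) hL0 (by linarith) (by linarith) S hSm (fun r hr => hSL r hr)
    by_contra hcon
    push Not at hcon
    rw [comap_subtype_coe_apply measurableSet_Ioi] at hcon
    set p : Polynomial ℂ := MvPolynomial.aeval
      (fun j => Polynomial.C ((x0 j : ℝ) : ℂ) + Polynomial.C ((θ.1 j : ℝ) : ℂ) * Polynomial.X) P with hp
    have hpd : p.natDegree ≤ d := by
      have := MvPolynomial.aeval_natDegree_le (n := 1) P (le_of_eq hd.symm)
        (fun j => Polynomial.C ((x0 j : ℝ) : ℂ) + Polynomial.C ((θ.1 j : ℝ) : ℂ) * Polynomial.X)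
        (fun j => by compute_degree)
      simpa using this
    have hpe : ∀ r : ℝ, ‖p.eval (r : ℂ)‖ = A (x0 + r • θ.1) := by
      intro r
      rw [hp, hA]
      congr 1
      rw [← Polynomial.coe_aeval_eq_eval, ← AlgHom.restrictScalars_apply ℂ, ← AlgHom.comp_apply,
        MvPolynomial.comp_aeval]
      rw [MvPolynomial.aeval_eq_eval]
      congr 2
      ext j
      simp
      ring
    have hrem := remez1 p d hpd (Subtype.val '' S) L (1 - u) (by
      rintro _ ⟨r, hr, rfl⟩
      exact ⟨r.2, hSL r hr⟩) (by linarith) (by linarith) hL0 hcon c (by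
      rintro _ ⟨r, hr, rfl⟩
      rw [hpe]
      exact hr.2)
    have hp0 := hpe 0
    simp only [Complex.ofReal_zero, zero_smul, add_zero] at hp0
    rw [hp0, show (2 - (1 - u)) / (1 - u) = F by rw [hF]; ring, hcF] at hrem
    linarith
  rw [measure_preimage_add, measure_preimage_add] at hkey
  have hMv : volume (Metric.ball (0 : EuclideanSpace ℝ (Fin n)) R) = ENNReal.ofReal M := by
    rw [hM, ENNReal.ofReal_toReal]
    exact measure_ball_lt_top.ne
  rw [hMv, ← ENNReal.ofReal_mul ht0.le, show t * M = ε by rw [ht]; field_simp] at hkey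
  exact hkey
end

section
/- Let n ≥ 1, L > 0, 0 < δ ≤ 1, N ∈ ℕ and f ∈ E_N. For each α ∈ (Lℤ)ⁿ let Q(α) = { x ∈ ℝⁿ : |x_j − α_j| < L/2 for all 1 ≤ j ≤ n }, and call the cube Q(α) bad if there exists a multi-index β ∈ ℕⁿ with |β| > 0 such that ∫_{Q(α)} |∂_x^β f(x)|² dx > e^{e δ^{−2}} · (8δ²(2ⁿ+1))^{|β|} · (|β|!)² · e^{2δ^{−1}√N} · ∫_{Q(α)} |f(x)|² dx. Then the sum over all bad cubes satisfies Σ_{bad cubes} ∫_{Q(α)} |f(x)|² dx ≤ (1/2) ‖f‖²_{L²(ℝⁿ)}; equivalently, ‖f‖²_{L²(ℝⁿ)} ≤ 2 ∫_{∪ good cubes} |f(x)|² dx, where a cube is good if it is not bad. -/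
open MeasureTheory

noncomputable section

/-- The one-dimensional Hermite functions
`φ_k(x) = ((-1)^k / √(2^k k! √π)) e^{x²/2} (d/dx)^k e^{-x²}`. -/
def hermiteFn (k : ℕ) (x : ℝ) : ℝ :=
  ((-1 : ℝ) ^ k / Real.sqrt (2 ^ k * Nat.factorial k * Real.sqrt Real.pi)) *
    Real.exp (x ^ 2 / 2) * iteratedDeriv k (fun y => Real.exp (-(y ^ 2))) x

/-- The `n`-dimensional Hermite functions `Φ_α(x) = ∏_j φ_{α_j}(x_j)`, viewed as
complex-valued functions. -/
def hermitePhi {n : ℕ} (α : Fin n → ℕ) (x : EuclideanSpace ℝ (Fin n)) : ℂ :=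
  ∏ j, (hermiteFn (α j) (x j) : ℂ)

/-- `E_N`, the span of the Hermite functions `Φ_α` with `|α| ≤ N`. -/
def hermiteSpan (n N : ℕ) : Submodule ℂ (EuclideanSpace ℝ (Fin n) → ℂ) :=
  Submodule.span ℂ {f | ∃ α : Fin n → ℕ, (∑ j, α j) ≤ N ∧ f = hermitePhi α}

end
noncomputable section

/-- The partial derivative `∂_{x_j}` of a function on `ℝⁿ`. -/
def partialDerivE {n : ℕ} (j : Fin n) (f : EuclideanSpace ℝ (Fin n) → ℂ) :
    EuclideanSpace ℝ (Fin n) → ℂ :=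
  fun x => fderiv ℝ f x (EuclideanSpace.single j 1)

/-- The iterated partial derivative `∂_x^β = ∂_{x_1}^{β_1} ⋯ ∂_{x_n}^{β_n}`. -/
def multiDerivE {n : ℕ} (β : Fin n → ℕ) (f : EuclideanSpace ℝ (Fin n) → ℂ) :
    EuclideanSpace ℝ (Fin n) → ℂ :=
  (List.finRange n).foldr (fun j g => (partialDerivE j)^[β j] g) f

end

noncomputable section

/-- The open cube of side `L` centered at `L·α`, for `α ∈ ℤⁿ`. -/
def cubeQ (n : ℕ) (L : ℝ) (α : Fin n → ℤ) : Set (EuclideanSpace ℝ (Fin n)) :=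
  {x | ∀ j, |x j - L * α j| < L / 2}

/-- A cube `Q(α)` is bad for `f` if some derivative of positive order is large on it:
`∫_{Q(α)} |∂_x^β f|² > e^{e δ⁻²} (8δ²(2ⁿ+1))^{|β|} (|β|!)² e^{2δ⁻¹√N} ∫_{Q(α)} |f|²`. -/
def IsBadCube (n : ℕ) (L δ : ℝ) (N : ℕ) (f : EuclideanSpace ℝ (Fin n) → ℂ)
    (α : Fin n → ℤ) : Prop :=
  ∃ β : Fin n → ℕ, 0 < ∑ j, β j ∧
    Real.exp (Real.exp 1 / δ ^ 2) * (8 * δ ^ 2 * (2 ^ n + 1)) ^ (∑ j, β j) *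
        (Nat.factorial (∑ j, β j) : ℝ) ^ 2 * Real.exp (2 * δ⁻¹ * Real.sqrt N) *
        (∫ x in cubeQ n L α, ‖f x‖ ^ 2) <
      ∫ x in cubeQ n L α, ‖multiDerivE β f x‖ ^ 2

end


section HermiteOneD

lemma gauss_contDiff : ContDiff ℝ ⊤ (fun y : ℝ => Real.exp (-(y ^ 2))) := by fun_prop

lemma gauss_hasDerivAt (k : ℕ) (x : ℝ) :
    HasDerivAt (iteratedDeriv k (fun y : ℝ => Real.exp (-(y ^ 2))))
      (iteratedDeriv (k + 1) (fun y : ℝ => Real.exp (-(y ^ 2))) x) x := by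
  rw [iteratedDeriv_succ]
  apply DifferentiableAt.hasDerivAt
  apply (ContDiff.differentiable_iteratedDeriv k gauss_contDiff _).differentiableAt
  exact WithTop.coe_lt_top (k : ℕ∞)

lemma gauss_one (x : ℝ) : iteratedDeriv 1 (fun y : ℝ => Real.exp (-(y ^ 2))) x
    = -2 * x * iteratedDeriv 0 (fun y : ℝ => Real.exp (-(y ^ 2))) x := by
  rw [iteratedDeriv_one, iteratedDeriv_zero]
  have : HasDerivAt (fun y : ℝ => Real.exp (-(y ^ 2))) (Real.exp (-(x^2)) * (-(2 * x))) x := by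
    have := ((hasDerivAt_pow 2 x).neg).exp
    simpa using this
  rw [this.deriv]; ring

lemma gauss_rec (k : ℕ) : ∀ x : ℝ, iteratedDeriv (k + 2) (fun y : ℝ => Real.exp (-(y ^ 2))) x
    = -2 * x * iteratedDeriv (k + 1) (fun y : ℝ => Real.exp (-(y ^ 2))) x
      - 2 * (k + 1) * iteratedDeriv k (fun y : ℝ => Real.exp (-(y ^ 2))) x := by
  induction k with
  | zero =>
    intro x
    have h1 := gauss_hasDerivAt 1 x
    have h2 : HasDerivAt (fun x : ℝ => -2 * x * iteratedDeriv 0 (fun y : ℝ => Real.exp (-(y ^ 2))) x)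
      _ x := ((hasDerivAt_id x).const_mul (-2)).mul (gauss_hasDerivAt 0 x)
    have h3 : iteratedDeriv 1 (fun y : ℝ => Real.exp (-(y ^ 2))) = _ := funext gauss_one
    rw [h3] at h1
    have := h1.unique h2
    simp only [id] at this
    push_cast
    simp only [zero_add] at this ⊢
    rw [show (2:ℕ) = 1 + 1 from rfl, this]; ring
  | succ k ih =>
    intro x
    have h1 := gauss_hasDerivAt (k + 2) x
    have h2 : HasDerivAt (fun x : ℝ => -2 * x * iteratedDeriv (k + 1) (fun y : ℝ => Real.exp (-(y ^ 2))) x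
      - 2 * (k + 1) * iteratedDeriv k (fun y : ℝ => Real.exp (-(y ^ 2))) x)
      _ x := (((hasDerivAt_id x).const_mul (-2)).mul (gauss_hasDerivAt (k + 1) x)).sub
        ((gauss_hasDerivAt k x).const_mul (2 * ((k : ℝ) + 1)))
    rw [funext ih] at h1
    have := h1.unique h2
    simp only [id] at this
    push_cast
    rw [show k + 1 + 2 = k + 2 + 1 from rfl, this]; ring

lemma gauss_poly (k : ℕ) : ∃ p : Polynomial ℝ, ∀ x : ℝ,
    iteratedDeriv k (fun y : ℝ => Real.exp (-(y ^ 2))) x = p.eval x * Real.exp (-(x ^ 2)) := by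
  induction k using Nat.strong_induction_on with
  | _ k ih =>
    match k, ih with
    | 0, _ => exact ⟨1, fun x => by simp⟩
    | 1, ih =>
      refine ⟨-2 * Polynomial.X, fun x => ?_⟩
      rw [gauss_one]; simp
    | k + 2, ih =>
      obtain ⟨p, hp⟩ := ih k (by omega)
      obtain ⟨q, hq⟩ := ih (k + 1) (by omega)
      refine ⟨-2 * Polynomial.X * q - Polynomial.C (2 * ((k : ℝ) + 1)) * p, fun x => ?_⟩
      rw [gauss_rec, hp, hq]; simp; ring

lemma poly_gauss_integrable (p : Polynomial ℝ) :
    Integrable (fun x : ℝ => p.eval x * Real.exp (-(x ^ 2))) := by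
  induction p using Polynomial.induction_on' with
  | add p q hp hq =>
    have := hp.add hq
    refine this.congr (Filter.Eventually.of_forall fun x => ?_)
    simp; ring
  | monomial m a =>
    have h := integrable_rpow_mul_exp_neg_mul_sq (b := 1) one_pos (s := m)
      (by have : (0:ℝ) ≤ m := Nat.cast_nonneg m
          linarith)
    refine (h.const_mul a).congr (Filter.Eventually.of_forall fun x => ?_)
    simp [Polynomial.eval_monomial]; ring

lemma hermiteFn_mul_integrable (j k : ℕ) :
    Integrable (fun x : ℝ => hermiteFn j x * hermiteFn k x) := by
  obtain ⟨p, hp⟩ := gauss_poly j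
  obtain ⟨q, hq⟩ := gauss_poly k
  refine ((poly_gauss_integrable (p * q)).const_mul
    (((-1 : ℝ) ^ j / Real.sqrt (2 ^ j * Nat.factorial j * Real.sqrt Real.pi)) *
    ((-1 : ℝ) ^ k / Real.sqrt (2 ^ k * Nat.factorial k * Real.sqrt Real.pi)))).congr
    (Filter.Eventually.of_forall fun x => ?_)
  simp only [hermiteFn, hp, hq, Polynomial.eval_mul]
  have : Real.exp (x ^ 2 / 2) * Real.exp (x ^ 2 / 2) * Real.exp (-(x^2)) = 1 := by
    rw [← Real.exp_add, ← Real.exp_add]; simp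
  linear_combination (-1) * (((-1 : ℝ) ^ j / Real.sqrt (2 ^ j * Nat.factorial j * Real.sqrt Real.pi)) *
    ((-1 : ℝ) ^ k / Real.sqrt (2 ^ k * Nat.factorial k * Real.sqrt Real.pi)) *
      (Polynomial.eval x p * Polynomial.eval x q * Real.exp (-(x^2)))) * this

lemma hermite_const_succ (k : ℕ) :
    (-1 : ℝ) ^ k / Real.sqrt (2 ^ k * Nat.factorial k * Real.sqrt Real.pi) =
    - Real.sqrt (2 * ((k + 1 : ℕ) : ℝ)) *
    ((-1 : ℝ) ^ (k+1) / Real.sqrt (2 ^ (k+1) * Nat.factorial (k+1) * Real.sqrt Real.pi)) := by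
  have : (2 : ℝ) ^ (k+1) * Nat.factorial (k+1) * Real.sqrt Real.pi
    = (2 * ((k + 1 : ℕ) : ℝ)) * (2 ^ k * Nat.factorial k * Real.sqrt Real.pi) := by
    rw [Nat.factorial_succ]; push_cast; ring
  rw [this, Real.sqrt_mul (by positivity) (2 ^ k * Nat.factorial k * Real.sqrt Real.pi)]
  have h1 : 0 < Real.sqrt (2 * ((k + 1 : ℕ) : ℝ)) := by positivity
  have h2 : 0 < Real.sqrt (2 ^ k * Nat.factorial k * Real.sqrt Real.pi) := by positivity
  field_simp
  ring

lemma hermiteFn_hasDerivAt_aux (k : ℕ) (x : ℝ) :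
    HasDerivAt (hermiteFn k)
      (x * hermiteFn k x - Real.sqrt (2 * ((k + 1 : ℕ) : ℝ)) * hermiteFn (k + 1) x) x := by
  have h0 : HasDerivAt (fun x : ℝ => Real.exp (x ^ 2 / 2)) (Real.exp (x ^ 2 / 2) * x) x := by
    have := ((hasDerivAt_pow 2 x).div_const 2).exp
    simpa using this
  have h1 := (h0.const_mul ((-1 : ℝ) ^ k / Real.sqrt (2 ^ k * Nat.factorial k * Real.sqrt Real.pi))).mul
    (gauss_hasDerivAt k x)
  refine HasDerivAt.congr_deriv (f := hermiteFn k) h1 ?_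
  have h := hermite_const_succ k
  simp only [hermiteFn]
  linear_combination (Real.exp (x ^ 2 / 2) *
    (iteratedDeriv (k + 1) (fun y : ℝ => Real.exp (-(y ^ 2))) x)) * h

lemma hermiteFn_mul_x (k : ℕ) (x : ℝ) :
    x * hermiteFn k x = Real.sqrt (2 * (k : ℝ)) / 2 * hermiteFn (k - 1) x +
      Real.sqrt (2 * ((k + 1 : ℕ) : ℝ)) / 2 * hermiteFn (k + 1) x := by
  cases k with
  | zero =>
    have h := hermite_const_succ 0
    have h1 := gauss_one x
    simp only [hermiteFn, zero_add] at *
    rw [h, h1]; simp; ring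
  | succ k =>
    have h := hermite_const_succ k
    have h' := hermite_const_succ (k + 1)
    have h1 := gauss_rec k x
    have hs : Real.sqrt (2 * ((k + 1 : ℕ) : ℝ)) ^ 2 = 2 * (k + 1) := by
      rw [Real.sq_sqrt (by positivity)]; push_cast; ring
    simp only [hermiteFn, Nat.add_sub_cancel] at *
    rw [show k + 1 + 1 = k + 2 from rfl] at *
    rw [h1, h, h']
    linear_combination (-1 / 2) * (-1 : ℝ) ^ (k+2) / Real.sqrt (2 ^ (k+2) * Nat.factorial (k+2) * Real.sqrt Real.pi) *
      Real.sqrt (2 * ((k + 2 : ℕ) : ℝ)) * Real.exp (x ^ 2 / 2) *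
      iteratedDeriv k (fun y : ℝ => Real.exp (-(y ^ 2))) x * hs

lemma hermiteFn_hasDerivAt (k : ℕ) (x : ℝ) :
    HasDerivAt (hermiteFn k)
      (Real.sqrt (2 * (k : ℝ)) / 2 * hermiteFn (k - 1) x -
        Real.sqrt (2 * ((k + 1 : ℕ) : ℝ)) / 2 * hermiteFn (k + 1) x) x := by
  convert hermiteFn_hasDerivAt_aux k x using 1
  rw [hermiteFn_mul_x]; ring

lemma hermiteFn_ladder (j k : ℕ) :
    Real.sqrt (2 * (k : ℝ)) * ∫ x, hermiteFn j x * hermiteFn (k - 1) x =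
    Real.sqrt (2 * ((j + 1 : ℕ) : ℝ)) * ∫ x, hermiteFn (j + 1) x * hermiteFn k x := by
  have I := hermiteFn_mul_integrable
  have key : ∫ x, (Real.sqrt (2 * (k : ℝ)) * (hermiteFn j x * hermiteFn (k - 1) x)
      - Real.sqrt (2 * ((j + 1 : ℕ) : ℝ)) * (hermiteFn (j + 1) x * hermiteFn k x)) = 0 := by
    refine integral_eq_zero_of_hasDerivAt_of_integrable
      (f := fun x => hermiteFn j x * hermiteFn k x) (fun x => ?_)
      (((I _ _).const_mul _).sub ((I _ _).const_mul _)) (I j k)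
    refine ((hermiteFn_hasDerivAt_aux j x).mul (hermiteFn_hasDerivAt k x)).congr_deriv ?_
    have := hermiteFn_mul_x k x
    linear_combination hermiteFn j x * this
  rw [integral_sub ((I _ _).const_mul _) ((I _ _).const_mul _), integral_const_mul,
    integral_const_mul] at key
  linarith

lemma hermiteFn_orthonormal (j k : ℕ) :
    ∫ x, hermiteFn j x * hermiteFn k x = if j = k then 1 else 0 := by
  induction j generalizing k with
  | zero =>
    cases k with
    | zero =>
      have h := integral_gaussian 1
      simp only [hermiteFn]
      simp
      have : ∀ x : ℝ, (√√Real.pi)⁻¹ * Real.exp (x ^ 2 / 2) * Real.exp (-x ^ 2) *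
         ((√√Real.pi)⁻¹ * Real.exp (x ^ 2 / 2) * Real.exp (-x ^ 2)) =
         (√Real.pi)⁻¹ * Real.exp (-1 * x ^ 2) := by
        intro x
        have h1 : √√Real.pi ^ 2 = √Real.pi := Real.sq_sqrt (by positivity)
        have h2 : Real.exp (x ^ 2 / 2) * Real.exp (-x ^ 2) * (Real.exp (x ^ 2 / 2) *
          Real.exp (-x ^ 2)) = Real.exp (-1 * x ^ 2) := by
          rw [← Real.exp_add, ← Real.exp_add]; ring_nf
        rw [← h2]; nth_rewrite 3 [← h1]; ring
      simp_rw [this]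
      rw [integral_const_mul, h]
      have : 0 < √Real.pi := by positivity
      simp; field_simp
    | succ k =>
      have h := hermiteFn_ladder k 0
      have : 0 < Real.sqrt (2 * ((k + 1 : ℕ) : ℝ)) := by positivity
      simp_rw [mul_comm (hermiteFn 0 _)]
      rw [Nat.cast_zero, mul_zero, Real.sqrt_zero, zero_mul] at h
      have h := (mul_eq_zero.1 h.symm).resolve_left this.ne'
      simp [h]
  | succ j ih =>
    have h := hermiteFn_ladder j k
    have hp : 0 < Real.sqrt (2 * ((j + 1 : ℕ) : ℝ)) := by positivity
    cases k with
    | zero =>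
      rw [Nat.cast_zero, mul_zero, Real.sqrt_zero, zero_mul] at h
      have h := (mul_eq_zero.1 h.symm).resolve_left hp.ne'
      simp [h]
    | succ k =>
      rw [Nat.add_sub_cancel, ih] at h
      split_ifs at h with hjk
      · subst hjk
        simp
        have := mul_left_cancel₀ hp.ne' h
        exact this.symm
      · rw [mul_zero] at h
        have := (mul_eq_zero.1 h.symm).resolve_left hp.ne'
        rw [this, if_neg (by omega)]

end HermiteOneD

section HermiteND

variable {n : ℕ}

lemma conj_hermitePhi (α : Fin n → ℕ) (x : EuclideanSpace ℝ (Fin n)) :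
    (starRingEnd ℂ) (hermitePhi α x) = hermitePhi α x := by
  simp [hermitePhi, map_prod]

lemma hermitePhi_mul (α β : Fin n → ℕ) :
    (fun x => hermitePhi α x * hermitePhi β x) =
      (fun y : Fin n → ℝ => ∏ j, ((hermiteFn (α j) (y j) * hermiteFn (β j) (y j) : ℝ) : ℂ))
        ∘ (@WithLp.ofLp 2 (Fin n → ℝ)) := by
  ext x
  simp [hermitePhi, Finset.prod_mul_distrib]

lemma ofLp_emb : MeasurableEmbedding (@WithLp.ofLp 2 (Fin n → ℝ)) :=
  (MeasurableEquiv.toLp 2 (Fin n → ℝ)).symm.measurableEmbedding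

lemma hermitePhi_mul_integrable (α β : Fin n → ℕ) :
    Integrable (fun x => hermitePhi α x * hermitePhi β x) := by
  rw [hermitePhi_mul, (PiLp.volume_preserving_ofLp (Fin n)).integrable_comp_emb ofLp_emb]
  exact Integrable.fintype_prod (f := fun j y => ((hermiteFn (α j) y * hermiteFn (β j) y : ℝ) : ℂ))
    (fun j => (hermiteFn_mul_integrable _ _).ofReal)

lemma hermitePhi_orthonormal (α β : Fin n → ℕ) :
    ∫ x, hermitePhi α x * hermitePhi β x = if α = β then 1 else 0 := by
  rw [hermitePhi_mul]
  have := (PiLp.volume_preserving_ofLp (Fin n)).integral_comp ofLp_emb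
    (fun y : Fin n → ℝ => ∏ j, ((hermiteFn (α j) (y j) * hermiteFn (β j) (y j) : ℝ) : ℂ))
  simp only [Function.comp_def]
  rw [this, integral_fintype_prod_volume_eq_prod
    (fun j y => ((hermiteFn (α j) y * hermiteFn (β j) y : ℝ) : ℂ))]
  simp_rw [integral_complex_ofReal, hermiteFn_orthonormal]
  split_ifs with h
  · subst h; simp
  · obtain ⟨j, hj⟩ := Function.ne_iff.1 h
    exact Finset.prod_eq_zero (Finset.mem_univ j) (by simp [hj])

lemma hermite_norm_sq {ι : Type*} (s : Finset ι) (d : ι → ℂ) (σ : ι → Fin n → ℕ)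
    (hσ : Set.InjOn σ s) :
    Integrable (fun x => ‖∑ i ∈ s, d i * hermitePhi (σ i) x‖ ^ 2) ∧
      ∫ x, ‖∑ i ∈ s, d i * hermitePhi (σ i) x‖ ^ 2 = ∑ i ∈ s, ‖d i‖ ^ 2 := by
  classical
  have hF : ∀ x, ((‖∑ i ∈ s, d i * hermitePhi (σ i) x‖ ^ 2 : ℝ) : ℂ) =
      ∑ i ∈ s, ∑ k ∈ s, (d i * (starRingEnd ℂ) (d k)) * (hermitePhi (σ i) x * hermitePhi (σ k) x) := by
    intro x
    push_cast
    rw [← Complex.mul_conj', map_sum, Finset.sum_mul_sum]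
    refine Finset.sum_congr rfl fun i _ => Finset.sum_congr rfl fun k _ => ?_
    rw [map_mul, conj_hermitePhi]; ring
  have hI : ∀ i k, Integrable (fun x => (d i * (starRingEnd ℂ) (d k)) *
      (hermitePhi (σ i) x * hermitePhi (σ k) x)) := fun i k =>
    (hermitePhi_mul_integrable _ _).const_mul _
  have hI2 : Integrable (fun x => ((‖∑ i ∈ s, d i * hermitePhi (σ i) x‖ ^ 2 : ℝ) : ℂ)) := by
    simp_rw [hF]
    exact integrable_finsetSum _ fun i _ => integrable_finsetSum _ fun k _ => hI i k
  refine ⟨hI2.re, ?_⟩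
  have : ((∫ x, ‖∑ i ∈ s, d i * hermitePhi (σ i) x‖ ^ 2 : ℝ) : ℂ) =
      ((∑ i ∈ s, ‖d i‖ ^ 2 : ℝ) : ℂ) := by
    rw [← integral_complex_ofReal]
    simp_rw [hF]
    rw [integral_finsetSum _ fun i _ => integrable_finsetSum _ fun k _ => hI i k]
    push_cast
    refine Finset.sum_congr rfl fun i hi => ?_
    rw [integral_finsetSum _ fun k _ => hI i k]
    simp_rw [integral_const_mul, hermitePhi_orthonormal]
    rw [Finset.sum_eq_single i]
    · simp [Complex.mul_conj']
    · intro k hk hki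
      rw [if_neg fun h => hki (hσ hk hi h.symm)]; simp
    · intro h; exact absurd hi h
  exact_mod_cast this

lemma hermitePhi_update (α : Fin n → ℕ) (j : Fin n) (m : ℕ) (x : EuclideanSpace ℝ (Fin n)) :
    hermitePhi (Function.update α j m) x =
      (∏ i ∈ Finset.univ.erase j, (hermiteFn (α i) (x i) : ℂ)) * (hermiteFn m (x j) : ℂ) := by
  rw [hermitePhi, ← Finset.prod_erase_mul _ _ (Finset.mem_univ j)]
  congr 1
  · refine Finset.prod_congr rfl fun i hi => ?_
    rw [Function.update_of_ne (Finset.ne_of_mem_erase hi)]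
  · simp

lemma hermitePhi_hasFDerivAt (α : Fin n → ℕ) (x : EuclideanSpace ℝ (Fin n)) :
    ∃ T : EuclideanSpace ℝ (Fin n) →L[ℝ] ℂ, HasFDerivAt (hermitePhi α) T x ∧
      ∀ j, T (EuclideanSpace.single j 1) =
        ((Real.sqrt (2 * (α j : ℝ)) / 2 : ℝ) : ℂ) * hermitePhi (Function.update α j (α j - 1)) x -
        ((Real.sqrt (2 * ((α j + 1 : ℕ) : ℝ)) / 2 : ℝ) : ℂ) *
          hermitePhi (Function.update α j (α j + 1)) x := by
  have h1 : ∀ i : Fin n, HasFDerivAt (fun x : EuclideanSpace ℝ (Fin n) => (hermiteFn (α i) (x i) : ℂ))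
      _ x := fun i =>
    ((hermiteFn_hasDerivAt (α i) (x i)).ofReal_comp.hasFDerivAt).comp x
      ((EuclideanSpace.proj i : EuclideanSpace ℝ (Fin n) →L[ℝ] ℝ).hasFDerivAt)
  have h2 := HasFDerivAt.finsetProd (u := Finset.univ) (fun i _ => h1 i)
  refine ⟨_, h2, fun j => ?_⟩
  simp only [hermitePhi_update]
  simp
  ring

end HermiteND

section Bernstein

variable {n : ℕ}

lemma hermitePhi_mem {N : ℕ} {α : Fin n → ℕ} (h : ∑ j, α j ≤ N) :
    hermitePhi α ∈ hermiteSpan n N := Submodule.subset_span ⟨α, h, rfl⟩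

lemma hermiteSpan_repr {N : ℕ} {f : EuclideanSpace ℝ (Fin n) → ℂ} (hf : f ∈ hermiteSpan n N) :
    ∃ (s : Finset (Fin n → ℕ)) (c : (Fin n → ℕ) → ℂ), (∀ α ∈ s, ∑ j, α j ≤ N) ∧
      f = fun x => ∑ α ∈ s, c α * hermitePhi α x := by
  have : {f | ∃ α : Fin n → ℕ, (∑ j, α j) ≤ N ∧ f = hermitePhi α} =
      hermitePhi '' {α : Fin n → ℕ | ∑ j, α j ≤ N} := by
    ext g; simp [eq_comm]
  rw [hermiteSpan, this, Finsupp.mem_span_image_iff_linearCombination] at hf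
  obtain ⟨l, hl, rfl⟩ := hf
  refine ⟨l.support, l, fun α hα => (Finsupp.mem_supported _ _).1 hl hα, ?_⟩
  ext x
  simp [Finsupp.linearCombination_apply, Finsupp.sum]

lemma hermiteSpan_integrable {N : ℕ} {f : EuclideanSpace ℝ (Fin n) → ℂ} (hf : f ∈ hermiteSpan n N) :
    Integrable (fun x => ‖f x‖ ^ 2) := by
  obtain ⟨s, c, -, rfl⟩ := hermiteSpan_repr hf
  exact (hermite_norm_sq s c id Function.injective_id.injOn).1

lemma sum_update (α : Fin n → ℕ) (j : Fin n) (m : ℕ) :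
    ∑ i, Function.update α j m i + α j = ∑ i, α i + m := by
  rw [← Finset.sum_erase_add _ _ (Finset.mem_univ j), ← Finset.sum_erase_add _ α (Finset.mem_univ j)]
  rw [Finset.sum_congr rfl fun i hi => Function.update_of_ne (Finset.ne_of_mem_erase hi) _ _]
  simp; ring

lemma partialDerivE_step {M : ℕ} {f : EuclideanSpace ℝ (Fin n) → ℂ} (hf : f ∈ hermiteSpan n M)
    (j : Fin n) : partialDerivE j f ∈ hermiteSpan n (M + 1) ∧
      ∫ x, ‖partialDerivE j f x‖ ^ 2 ≤ 2 * ((M : ℝ) + 1) * ∫ x, ‖f x‖ ^ 2 := by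
  classical
  obtain ⟨s, c, hs, rfl⟩ := hermiteSpan_repr hf
  set a : (Fin n → ℕ) → ℂ := fun α => ((Real.sqrt (2 * (α j : ℝ)) / 2 : ℝ) : ℂ) with ha
  set b : (Fin n → ℕ) → ℂ := fun α => ((Real.sqrt (2 * ((α j + 1 : ℕ) : ℝ)) / 2 : ℝ) : ℂ) with hb
  have hD : partialDerivE j (fun x => ∑ α ∈ s, c α * hermitePhi α x) = fun x =>
      ∑ α ∈ s, (c α * a α) * hermitePhi (Function.update α j (α j - 1)) x -
      ∑ α ∈ s, (c α * b α) * hermitePhi (Function.update α j (α j + 1)) x := by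
    ext x
    choose T hT1 hT2 using fun α : Fin n → ℕ => hermitePhi_hasFDerivAt α x
    have h : HasFDerivAt (fun x => ∑ α ∈ s, c α * hermitePhi α x) (∑ α ∈ s, c α • T α) x :=
      HasFDerivAt.fun_sum fun α _ => (hT1 α).const_mul (c α)
    rw [partialDerivE, h.fderiv, ← Finset.sum_sub_distrib]
    simp only [sum_apply, smul_apply, hT2, smul_eq_mul]
    refine Finset.sum_congr rfl fun α _ => ?_
    simp only [ha, hb]; ring
  have hP : ∀ x, ∑ α ∈ s, (c α * a α) * hermitePhi (Function.update α j (α j - 1)) x =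
      ∑ α ∈ s with α j ≠ 0, (c α * a α) * hermitePhi (Function.update α j (α j - 1)) x := by
    intro x
    rw [Finset.sum_filter_of_ne]
    intro α _ h h0
    apply h
    simp [ha, h0]
  constructor
  · rw [hD]
    have e1 : (fun x => ∑ α ∈ s, (c α * a α) * hermitePhi (Function.update α j (α j - 1)) x -
      ∑ α ∈ s, (c α * b α) * hermitePhi (Function.update α j (α j + 1)) x) =
      ∑ α ∈ s, (c α * a α) • hermitePhi (Function.update α j (α j - 1)) -
      ∑ α ∈ s, (c α * b α) • hermitePhi (Function.update α j (α j + 1)) := by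
      ext x; simp
    rw [e1]
    refine Submodule.sub_mem _ (Submodule.sum_mem _ fun α hα => Submodule.smul_mem _ _ ?_)
      (Submodule.sum_mem _ fun α hα => Submodule.smul_mem _ _ ?_)
    · apply hermitePhi_mem
      have := sum_update α j (α j - 1)
      have := hs α hα
      omega
    · apply hermitePhi_mem
      have := sum_update α j (α j + 1)
      have := hs α hα
      omega
  · rw [hD]
    simp_rw [hP]
    have i1 := hermite_norm_sq (s.filter fun α => α j ≠ 0) (fun α => c α * a α)
      (fun α => Function.update α j (α j - 1)) (by
        intro α hα β hβ h
        simp only [Finset.coe_filter, Set.mem_ofPred_eq] at hα hβ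
        ext i
        have := congrFun h i
        by_cases hi : i = j
        · subst hi; simp at this; omega
        · simpa [hi] using this)
    have i2 := hermite_norm_sq s (fun α => c α * b α)
      (fun α => Function.update α j (α j + 1)) (by
        intro α hα β hβ h
        ext i
        have := congrFun h i
        by_cases hi : i = j
        · subst hi; simpa using this
        · simpa [hi] using this)
    have i3 := hermite_norm_sq s c id Function.injective_id.injOn
    simp only [id] at i3
    rw [i3.2]
    calc _ ≤ ∫ x, (2 * ‖∑ α ∈ s with α j ≠ 0, (c α * a α) *
              hermitePhi (Function.update α j (α j - 1)) x‖ ^ 2 +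
            2 * ‖∑ α ∈ s, (c α * b α) * hermitePhi (Function.update α j (α j + 1)) x‖ ^ 2) := by
          refine integral_mono_of_nonneg (Filter.Eventually.of_forall fun x => by positivity)
            ((i1.1.const_mul 2).add (i2.1.const_mul 2)) (Filter.Eventually.of_forall fun x => ?_)
          simp only
          have := norm_sub_le (∑ α ∈ s with α j ≠ 0, (c α * a α) *
              hermitePhi (Function.update α j (α j - 1)) x)
              (∑ α ∈ s, (c α * b α) * hermitePhi (Function.update α j (α j + 1)) x)
          have h2 := pow_le_pow_left₀ (norm_nonneg _) this 2
          nlinarith [sq_nonneg (‖∑ α ∈ s with α j ≠ 0, (c α * a α) *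
              hermitePhi (Function.update α j (α j - 1)) x‖ -
              ‖∑ α ∈ s, (c α * b α) * hermitePhi (Function.update α j (α j + 1)) x‖)]
      _ = 2 * ∑ α ∈ s with α j ≠ 0, ‖c α * a α‖ ^ 2 + 2 * ∑ α ∈ s, ‖c α * b α‖ ^ 2 := by
          rw [integral_add (i1.1.const_mul 2) (i2.1.const_mul 2), integral_const_mul,
            integral_const_mul, i1.2, i2.2]
      _ ≤ 2 * ∑ α ∈ s, ‖c α * a α‖ ^ 2 + 2 * ∑ α ∈ s, ‖c α * b α‖ ^ 2 := by
          gcongr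
          exact Finset.filter_subset _ _
      _ ≤ _ := by
          rw [Finset.mul_sum, Finset.mul_sum, Finset.mul_sum, ← Finset.sum_add_distrib]
          refine Finset.sum_le_sum fun α hα => ?_
          have ea : ‖a α‖ ^ 2 = (α j : ℝ) / 2 := by
            rw [ha]; simp only [Complex.norm_real, Real.norm_eq_abs, sq_abs]
            rw [div_pow, Real.sq_sqrt (by positivity)]; ring
          have eb : ‖b α‖ ^ 2 = ((α j : ℝ) + 1) / 2 := by
            rw [hb]; simp only [Complex.norm_real, Real.norm_eq_abs, sq_abs]
            rw [div_pow, Real.sq_sqrt (by positivity)]; push_cast; ring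
          rw [norm_mul, norm_mul, mul_pow, mul_pow, ea, eb]
          have : (α j : ℝ) ≤ M := by
            exact_mod_cast (Finset.single_le_sum (fun i _ => Nat.zero_le (α i))
              (Finset.mem_univ j)).trans (hs α hα)
          nlinarith [sq_nonneg ‖c α‖, mul_le_mul_of_nonneg_left this (sq_nonneg ‖c α‖)]

lemma multiDerivE_bound {N : ℕ} {f : EuclideanSpace ℝ (Fin n) → ℂ} (hf : f ∈ hermiteSpan n N)
    (β : Fin n → ℕ) : multiDerivE β f ∈ hermiteSpan n (N + ∑ j, β j) ∧
      (∫ x, ‖multiDerivE β f x‖ ^ 2) * (N.factorial : ℝ) ≤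
        2 ^ (∑ j, β j) * ((N + ∑ j, β j).factorial : ℝ) * ∫ x, ‖f x‖ ^ 2 := by
  have key : ∀ (m : ℕ) (j : Fin n) (k : ℕ) (g : EuclideanSpace ℝ (Fin n) → ℂ),
      (g ∈ hermiteSpan n (N + m) ∧ (∫ x, ‖g x‖ ^ 2) * (N.factorial : ℝ) ≤
        2 ^ m * ((N + m).factorial : ℝ) * ∫ x, ‖f x‖ ^ 2) →
      ((partialDerivE j)^[k] g ∈ hermiteSpan n (N + (m + k)) ∧
        (∫ x, ‖(partialDerivE j)^[k] g x‖ ^ 2) * (N.factorial : ℝ) ≤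
        2 ^ (m + k) * ((N + (m + k)).factorial : ℝ) * ∫ x, ‖f x‖ ^ 2) := by
    intro m j k g hg
    induction k with
    | zero => simpa using hg
    | succ k ih =>
      rw [Function.iterate_succ_apply']
      obtain ⟨h1, h2⟩ := partialDerivE_step ih.1 j
      refine ⟨h1, ?_⟩
      have hN : (0 : ℝ) ≤ N.factorial := by positivity
      calc _ ≤ (2 * (((N + (m + k) : ℕ) : ℝ) + 1) * ∫ x, ‖(partialDerivE j)^[k] g x‖ ^ 2) *
            (N.factorial : ℝ) := mul_le_mul_of_nonneg_right h2 hN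
        _ = 2 * (((N + (m + k) : ℕ) : ℝ) + 1) * ((∫ x, ‖(partialDerivE j)^[k] g x‖ ^ 2) *
            (N.factorial : ℝ)) := by ring
        _ ≤ 2 * (((N + (m + k) : ℕ) : ℝ) + 1) *
            (2 ^ (m + k) * ((N + (m + k)).factorial : ℝ) * ∫ x, ‖f x‖ ^ 2) :=
          mul_le_mul_of_nonneg_left ih.2 (by positivity)
        _ = _ := by
          rw [show N + (m + (k + 1)) = (N + (m + k)) + 1 by ring, Nat.factorial_succ]
          push_cast; ring
  have key2 : ∀ l : List (Fin n),
      (l.foldr (fun j g => (partialDerivE j)^[β j] g) f ∈ hermiteSpan n (N + (l.map β).sum) ∧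
      (∫ x, ‖l.foldr (fun j g => (partialDerivE j)^[β j] g) f x‖ ^ 2) * (N.factorial : ℝ) ≤
        2 ^ ((l.map β).sum) * ((N + (l.map β).sum).factorial : ℝ) * ∫ x, ‖f x‖ ^ 2) := by
    intro l
    induction l with
    | nil => simpa [mul_comm] using hf
    | cons j l ih =>
      have := key _ j (β j) _ ih
      simpa [add_comm] using this
  have := key2 (List.finRange n)
  have e : ((List.finRange n).map β).sum = ∑ j, β j := by
    rw [← List.ofFn_eq_map, List.sum_ofFn]
  rw [e] at this
  exact this

end Bernstein

section Constants

lemma bernstein_const (N k : ℕ) (hk : 0 < k) (δ : ℝ) (hδ : 0 < δ) :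
    (2 : ℝ) ^ k * ((N + k).factorial : ℝ) ≤
      (N.factorial : ℝ) * ((4 * δ ^ 2) ^ k * (k.factorial : ℝ) ^ 2 *
        (Real.exp (Real.exp 1 / δ ^ 2) * Real.exp (2 * δ⁻¹ * Real.sqrt N))) := by
  set E1 := Real.exp (Real.exp 1 / δ ^ 2)
  set E2 := Real.exp (2 * δ⁻¹ * Real.sqrt N) with hE2
  have hE1 : 1 ≤ E1 := Real.one_le_exp (by positivity)
  have hE2' : 1 ≤ E2 := Real.one_le_exp (by positivity)
  have hkf : (0 : ℝ) < k.factorial := by positivity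
  have h1 : ((N + k).factorial : ℝ) ≤ N.factorial * ((N : ℝ) + k) ^ k := by
    have := Nat.ascFactorial_le_pow_add N k
    rw [← Nat.factorial_mul_ascFactorial]
    exact_mod_cast Nat.mul_le_mul_left _ this
  have h2 : ((N : ℝ) + k) ^ k ≤ 2 ^ (k - 1) * ((N : ℝ) ^ k + (k : ℝ) ^ k) :=
    add_pow_le (by positivity) (by positivity) k
  have h3 : (N : ℝ) ^ k ≤ (δ ^ 2) ^ k * (k.factorial : ℝ) ^ 2 * E2 := by
    have := Real.pow_div_factorial_le_exp (x := δ⁻¹ * Real.sqrt N) (by positivity) k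
    rw [div_le_iff₀ hkf] at this
    have h := pow_le_pow_left₀ (by positivity) this 2
    have e : Real.exp (δ⁻¹ * Real.sqrt N) ^ 2 = E2 := by
      rw [hE2, ← Real.exp_nat_mul]; congr 1; push_cast; ring
    rw [mul_pow (Real.exp _), e] at h
    have e2 : (N : ℝ) ^ k = (δ ^ 2) ^ k * ((δ⁻¹ * Real.sqrt N) ^ k) ^ 2 := by
      rw [pow_right_comm _ k 2, ← mul_pow, mul_pow δ⁻¹, Real.sq_sqrt (by positivity)]
      congr 1; field_simp
    rw [e2]
    calc _ ≤ (δ ^ 2) ^ k * (E2 * (k.factorial : ℝ) ^ 2) := by gcongr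
      _ = _ := by ring
  have h4 : (k : ℝ) ^ k ≤ (δ ^ 2) ^ k * (k.factorial : ℝ) ^ 2 * E1 := by
    have a1 := Real.pow_div_factorial_le_exp (x := (k : ℝ)) (by positivity) k
    rw [div_le_iff₀ hkf] at a1
    have a2 := Real.pow_div_factorial_le_exp (x := Real.exp 1 / δ ^ 2) (by positivity) k
    rw [div_le_iff₀ hkf, div_pow, div_le_iff₀ (by positivity)] at a2
    have e : Real.exp (k : ℝ) = Real.exp 1 ^ k := by rw [← Real.exp_nat_mul]; simp
    rw [e] at a1
    calc _ ≤ Real.exp 1 ^ k * (k.factorial : ℝ) := a1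
      _ ≤ (E1 * k.factorial * (δ ^ 2) ^ k) * k.factorial := by gcongr
      _ = _ := by ring
  set D := (δ ^ 2) ^ k * (k.factorial : ℝ) ^ 2 with hD
  have hD0 : 0 ≤ D := by positivity
  have h5 : (N : ℝ) ^ k + (k : ℝ) ^ k ≤ 2 * (D * (E1 * E2)) := by
    have : D * E2 ≤ D * (E1 * E2) := by
      apply mul_le_mul_of_nonneg_left _ hD0; nlinarith
    have : D * E1 ≤ D * (E1 * E2) := by
      apply mul_le_mul_of_nonneg_left _ hD0; nlinarith
    linarith
  calc (2 : ℝ) ^ k * ((N + k).factorial : ℝ)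
      ≤ 2 ^ k * (N.factorial * (2 ^ (k - 1) * (2 * (D * (E1 * E2))))) := by
        refine mul_le_mul_of_nonneg_left (h1.trans ?_) (by positivity)
        refine mul_le_mul_of_nonneg_left (h2.trans ?_) (by positivity)
        exact mul_le_mul_of_nonneg_left h5 (by positivity)
    _ = _ := by
        obtain ⟨m, rfl⟩ : ∃ m, k = m + 1 := ⟨k - 1, by omega⟩
        rw [hD, Nat.add_sub_cancel, mul_pow 4, show (4 : ℝ) = 2 * 2 by norm_num, mul_pow 2 2]
        ring

lemma tsum_multi (n : ℕ) (t : ENNReal) :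
    ∑' β : Fin n → ℕ, t ^ (∑ j, β j) = ((1 - t)⁻¹) ^ n := by
  induction n with
  | zero => simp
  | succ n ih =>
    rw [← (Fin.consEquiv (fun _ => ℕ)).tsum_eq, ENNReal.tsum_prod']
    simp only [Fin.consEquiv, Equiv.coe_fn_mk, Fin.sum_univ_succ, Fin.cons_zero, Fin.cons_succ, pow_add]
    simp_rw [ENNReal.tsum_mul_left, ih, ENNReal.tsum_mul_right, ENNReal.tsum_geometric]
    ring

lemma three_mul_le (n : ℕ) : 3 * n ≤ 2 * (2 ^ n + 1) := by
  induction n with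
  | zero => simp
  | succ n ih =>
    rcases n with _ | _ | n
    · simp
    · simp
    · have : 4 ≤ 2 ^ (n + 2) := by
        have := Nat.one_le_two_pow (n := n)
        rw [pow_add]; omega
      have e : 2 ^ (n + 1 + 1 + 1) = 2 * 2 ^ (n + 2) := by ring
      rw [e]
      change 3 * (n + 2) ≤ 2 * (2 ^ (n + 2) + 1) at ih
      omega

lemma tsum_multi_le (n : ℕ) :
    ∑' β : Fin n → ℕ, (if β = 0 then 0 else
      ENNReal.ofReal ((1 / (2 * (2 ^ n + 1)) : ℝ) ^ (∑ j, β j))) ≤ ENNReal.ofReal (1 / 2) := by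
  set τ : ℝ := 1 / (2 * (2 ^ n + 1)) with hτ
  have h2 : (1 : ℝ) ≤ 2 ^ n := one_le_pow₀ (by norm_num)
  have hτ0 : 0 ≤ τ := by positivity
  have hτ1 : τ ≤ 1 / 4 := by
    rw [hτ]; apply one_div_le_one_div_of_le <;> linarith
  have hnτ : n * τ ≤ 1 / 3 := by
    have := three_mul_le n
    have h3 : (3 : ℝ) * n ≤ 2 * (2 ^ n + 1) := by exact_mod_cast this
    rw [hτ, mul_one_div, div_le_div_iff₀ (by positivity) (by norm_num)]
    linarith
  have hb : (2 / 3 : ℝ) ≤ (1 - τ) ^ n := by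
    have := one_add_mul_le_pow (a := -τ) (by linarith) n
    rw [← sub_eq_add_neg] at this
    linarith
  have htot : ∑' β : Fin n → ℕ, ENNReal.ofReal (τ ^ (∑ j, β j)) ≤ ENNReal.ofReal (3 / 2) := by
    simp_rw [ENNReal.ofReal_pow hτ0]
    rw [tsum_multi, ← ENNReal.ofReal_one, ← ENNReal.ofReal_sub _ hτ0,
      ← ENNReal.ofReal_inv_of_pos (by linarith), ← ENNReal.ofReal_pow (by
        apply inv_nonneg.2; linarith)]
    apply ENNReal.ofReal_le_ofReal
    rw [inv_pow, show (3 / 2 : ℝ) = (2 / 3)⁻¹ by norm_num]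
    exact inv_anti₀ (by norm_num) hb
  classical
  rw [ENNReal.tsum_eq_add_tsum_ite (0 : Fin n → ℕ)] at htot
  have e : ENNReal.ofReal (3 / 2) = 1 + ENNReal.ofReal (1 / 2) := by
    rw [← ENNReal.ofReal_one, ← ENNReal.ofReal_add] <;> norm_num
  rw [e] at htot
  simp only [Pi.zero_apply, Finset.sum_const_zero, pow_zero, ENNReal.ofReal_one] at htot
  have := (ENNReal.add_le_add_iff_left ENNReal.one_ne_top).1 htot
  convert this

end Constants

section Cubes

variable {n : ℕ}

lemma cubeQ_measurable (L : ℝ) (α : Fin n → ℤ) : MeasurableSet (cubeQ n L α) := by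
  have : cubeQ n L α = ⋂ j, {x | |x j - L * α j| < L / 2} := by
    ext x; simp [cubeQ]
  rw [this]
  refine MeasurableSet.iInter fun j => ?_
  exact (isOpen_lt (by fun_prop) (by fun_prop)).measurableSet

lemma cubeQ_disjoint (L : ℝ) (hL : 0 < L) : Pairwise (Function.onFun Disjoint (cubeQ n L)) := by
  intro α α' hne
  rw [Function.onFun, Set.disjoint_left]
  intro x hx hx'
  apply hne
  ext j
  have h1 := abs_lt.1 (hx j)
  have h2 := abs_lt.1 (hx' j)
  have h3 : L * ((α j : ℝ) - α' j) < L * 1 := by linarith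
  have h4 : L * ((α' j : ℝ) - α j) < L * 1 := by linarith
  have h5 := lt_of_mul_lt_mul_left h3 hL.le
  have h6 := lt_of_mul_lt_mul_left h4 hL.le
  have h7 : α j - α' j < 1 := by exact_mod_cast h5
  have h8 : α' j - α j < 1 := by exact_mod_cast h6
  omega

lemma cubeQ_cover (L : ℝ) (hL : 0 < L) :
    ∀ᵐ x : EuclideanSpace ℝ (Fin n), x ∈ ⋃ α, cubeQ n L α := by
  have h : ∀ᵐ x : EuclideanSpace ℝ (Fin n), ∀ j : Fin n, ∀ m : ℤ, x j ≠ L * (m + 1 / 2) := by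
    rw [ae_all_iff]; intro j
    rw [ae_all_iff]; intro m
    have : ∀ᵐ y : Fin n → ℝ, y j ≠ L * (m + 1 / 2) :=
      Measure.ae_eval_ne _ j _
    exact (PiLp.volume_preserving_ofLp (Fin n)).quasiMeasurePreserving.ae this
  filter_upwards [h] with x hx
  rw [Set.mem_iUnion]
  refine ⟨fun j => round (x j / L), fun j => ?_⟩
  have h1 := abs_sub_round (x j / L)
  have h2 : |x j / L - round (x j / L)| < 1 / 2 := by
    refine lt_of_le_of_ne h1 fun he => ?_
    rcases (abs_eq (by norm_num)).1 he with he | he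
    · apply hx j (round (x j / L))
      rw [← sub_eq_iff_eq_add'.2 (sub_eq_iff_eq_add'.1 he), add_sub_cancel]
      field_simp
    · apply hx j (round (x j / L) - 1)
      push_cast
      have : x j / L = round (x j / L) - 1 / 2 := by linarith
      rw [show (round (x j / L) : ℝ) - 1 + 1 / 2 = x j / L by linarith]
      field_simp
  have h3 : x j - L * round (x j / L) = L * (x j / L - round (x j / L)) := by field_simp
  rw [h3, abs_mul, abs_of_pos hL]
  nlinarith

lemma lintegral_cubes_le (L : ℝ) (hL : 0 < L) (g : EuclideanSpace ℝ (Fin n) → ENNReal) :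
    ∑' α, ∫⁻ x in cubeQ n L α, g x ≤ ∫⁻ x, g x := by
  rw [← lintegral_iUnion (cubeQ_measurable L) (cubeQ_disjoint L hL)]
  exact setLIntegral_le_lintegral _ _

end Cubes

lemma bad_cubes_lintegral (n : ℕ) (L : ℝ) (hL : 0 < L)
    (δ : ℝ) (hδ0 : 0 < δ) (N : ℕ)
    (f : EuclideanSpace ℝ (Fin n) → ℂ) (hf : f ∈ hermiteSpan n N) :
    ∑' α : {α : Fin n → ℤ // IsBadCube n L δ N f α},
        ENNReal.ofReal (∫ x in cubeQ n L α.1, ‖f x‖ ^ 2) ≤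
      ENNReal.ofReal ((1 / 2 : ℝ) * ∫ x, ‖f x‖ ^ 2) := by
  classical
  set K : ℕ → ℝ := fun k => Real.exp (Real.exp 1 / δ ^ 2) * (8 * δ ^ 2 * (2 ^ n + 1)) ^ k *
        (Nat.factorial k : ℝ) ^ 2 * Real.exp (2 * δ⁻¹ * Real.sqrt N) with hK
  have hKpos : ∀ k, 0 < K k := fun k => by simp only [hK]; positivity
  set I := ∫ x, ‖f x‖ ^ 2 with hI
  have hI0 : 0 ≤ I := integral_nonneg fun x => by positivity
  set F : (Fin n → ℕ) → (Fin n → ℤ) → ENNReal := fun β α =>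
    ∫⁻ x in cubeQ n L α, ENNReal.ofReal (‖multiDerivE β f x‖ ^ 2) with hF
  have hint : ∀ β : Fin n → ℕ, Integrable (fun x => ‖multiDerivE β f x‖ ^ 2) := fun β =>
    hermiteSpan_integrable (multiDerivE_bound hf β).1
  have hFQ : ∀ β α, ENNReal.ofReal (∫ x in cubeQ n L α, ‖multiDerivE β f x‖ ^ 2) = F β α :=
    fun β α => ofReal_integral_eq_lintegral_ofReal (hint β).integrableOn
      (Filter.Eventually.of_forall fun x => by positivity)
  set H : (Fin n → ℤ) → (Fin n → ℕ) → ENNReal := fun α β =>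
    if β = 0 then 0 else ENNReal.ofReal ((K (∑ j, β j))⁻¹) * F β α with hH
  have hbad : ∀ α : {α : Fin n → ℤ // IsBadCube n L δ N f α},
      ENNReal.ofReal (∫ x in cubeQ n L α.1, ‖f x‖ ^ 2) ≤ ∑' β, H α.1 β := by
    rintro ⟨α, β, hβ, hlt⟩
    refine le_trans ?_ (ENNReal.le_tsum β)
    have hβ0 : β ≠ 0 := by rintro rfl; simp at hβ
    simp only [hH, if_neg hβ0]
    rw [← hFQ, ← ENNReal.ofReal_mul (inv_nonneg.2 (hKpos _).le)]
    apply ENNReal.ofReal_le_ofReal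
    rw [inv_mul_eq_div, le_div_iff₀ (hKpos _), mul_comm]
    exact hlt.le
  have hB : ∀ β : Fin n → ℕ, ∑' α, H α β ≤ (if β = 0 then 0 else
      ENNReal.ofReal ((1 / (2 * (2 ^ n + 1)) : ℝ) ^ (∑ j, β j))) * ENNReal.ofReal I := by
    intro β
    by_cases hβ : β = 0
    · simp [hH, hβ]
    simp only [hH, if_neg hβ]
    rw [ENNReal.tsum_mul_left]
    have hk : 0 < ∑ j, β j := by
      rw [pos_iff_ne_zero]
      intro h
      apply hβ
      ext j
      exact (Finset.sum_eq_zero_iff.1 h) j (Finset.mem_univ j)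
    set k := ∑ j, β j with hkdef
    have h1 : (∫ x, ‖multiDerivE β f x‖ ^ 2) ≤ K k * ((1 / (2 * (2 ^ n + 1)) : ℝ) ^ k * I) := by
      have hb := (multiDerivE_bound hf β).2
      rw [← hkdef, ← hI] at hb
      have hc := bernstein_const N k hk δ hδ0
      have hN : (0 : ℝ) < N.factorial := by positivity
      have hd := hb.trans (mul_le_mul_of_nonneg_right hc hI0)
      refine le_of_mul_le_mul_right (hd.trans (le_of_eq ?_)) hN
      have e : (4 * δ ^ 2) ^ k = (8 * δ ^ 2 * (2 ^ n + 1)) ^ k * (1 / (2 * (2 ^ n + 1)) : ℝ) ^ k := by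
        rw [← mul_pow]; congr 1; field_simp; norm_num
      rw [e]; simp only [hK]; ring
    calc _ ≤ ENNReal.ofReal ((K k)⁻¹) * ENNReal.ofReal (∫ x, ‖multiDerivE β f x‖ ^ 2) := by
          gcongr
          rw [ofReal_integral_eq_lintegral_ofReal (hint β)
            (Filter.Eventually.of_forall fun x => by positivity)]
          exact lintegral_cubes_le L hL _
      _ ≤ ENNReal.ofReal ((K k)⁻¹) *
          ENNReal.ofReal (K k * ((1 / (2 * (2 ^ n + 1)) : ℝ) ^ k * I)) := by gcongr
      _ = _ := by
          rw [← ENNReal.ofReal_mul (inv_nonneg.2 (hKpos _).le), ← ENNReal.ofReal_mul (by positivity),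
            inv_mul_cancel_left₀ (hKpos _).ne']
  calc _ ≤ ∑' α : {α : Fin n → ℤ // IsBadCube n L δ N f α}, ∑' β, H α.1 β :=
        ENNReal.tsum_le_tsum hbad
    _ ≤ ∑' α, ∑' β, H α β :=
        ENNReal.tsum_comp_le_tsum_of_injective Subtype.val_injective (fun α => ∑' β, H α β)
    _ = ∑' β, ∑' α, H α β := ENNReal.tsum_comm
    _ ≤ ∑' β : Fin n → ℕ, (if β = 0 then 0 else
      ENNReal.ofReal ((1 / (2 * (2 ^ n + 1)) : ℝ) ^ (∑ j, β j))) * ENNReal.ofReal I :=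
        ENNReal.tsum_le_tsum hB
    _ ≤ ENNReal.ofReal (1 / 2) * ENNReal.ofReal I := by
        rw [ENNReal.tsum_mul_right]
        gcongr
        exact tsum_multi_le n
    _ = _ := by rw [← ENNReal.ofReal_mul (by norm_num)]

/-- **The bad cubes carry at most half of the `L²` mass.** For `f ∈ E_N` and `0 < δ ≤ 1`,
`Σ_{bad cubes} ∫_{Q(α)} |f|² ≤ (1/2) ‖f‖²_{L²(ℝⁿ)}`; equivalently,
`‖f‖²_{L²(ℝⁿ)} ≤ 2 ∫_{∪ good cubes} |f|²`. -/
theorem bad_cubes_estimate (n : ℕ) (hn : 1 ≤ n) (L : ℝ) (hL : 0 < L)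
    (δ : ℝ) (hδ0 : 0 < δ) (hδ1 : δ ≤ 1) (N : ℕ)
    (f : EuclideanSpace ℝ (Fin n) → ℂ) (hf : f ∈ hermiteSpan n N) :
    (∑' α : {α : Fin n → ℤ // IsBadCube n L δ N f α},
        ∫ x in cubeQ n L α.1, ‖f x‖ ^ 2) ≤ (1 / 2 : ℝ) * ∫ x, ‖f x‖ ^ 2 ∧
    (∫ x, ‖f x‖ ^ 2) ≤
      2 * ∫ x in ⋃ α ∈ {α : Fin n → ℤ | ¬ IsBadCube n L δ N f α}, cubeQ n L α,
        ‖f x‖ ^ 2 := by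
  have hmain := bad_cubes_lintegral n L hL δ hδ0 N f hf
  have hint : Integrable (fun x => ‖f x‖ ^ 2) := hermiteSpan_integrable hf
  have hnn : ∀ x, 0 ≤ ‖f x‖ ^ 2 := fun x => by positivity
  have hI0 : 0 ≤ ∫ x, ‖f x‖ ^ 2 := integral_nonneg hnn
  have hof : ∀ S : Set (EuclideanSpace ℝ (Fin n)),
      ENNReal.ofReal (∫ x in S, ‖f x‖ ^ 2) = ∫⁻ x in S, ENNReal.ofReal (‖f x‖ ^ 2) := fun S =>
    ofReal_integral_eq_lintegral_ofReal hint.integrableOn (Filter.Eventually.of_forall hnn)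
  constructor
  · have h := ENNReal.toReal_mono ENNReal.ofReal_ne_top hmain
    rw [ENNReal.tsum_toReal_eq fun _ => ENNReal.ofReal_ne_top,
      ENNReal.toReal_ofReal (by positivity)] at h
    refine le_trans (le_of_eq (tsum_congr fun α => ?_)) h
    rw [ENNReal.toReal_ofReal (integral_nonneg hnn)]
  · set G := ⋃ α ∈ {α : Fin n → ℤ | ¬ IsBadCube n L δ N f α}, cubeQ n L α with hG
    set B := ⋃ α : {α : Fin n → ℤ // IsBadCube n L δ N f α}, cubeQ n L α.1 with hB
    have hJ0 : 0 ≤ ∫ x in G, ‖f x‖ ^ 2 := integral_nonneg hnn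
    have hsub : (⋃ α, cubeQ n L α) ⊆ B ∪ G := by
      intro x hx
      obtain ⟨α, hα⟩ := Set.mem_iUnion.1 hx
      by_cases hb : IsBadCube n L δ N f α
      · exact Or.inl (Set.mem_iUnion.2 ⟨⟨α, hb⟩, hα⟩)
      · exact Or.inr (Set.mem_iUnion₂.2 ⟨α, hb, hα⟩)
    have hae : (B ∪ G : Set (EuclideanSpace ℝ (Fin n))) =ᵐ[volume] Set.univ := by
      rw [Filter.eventuallyEq_univ]
      filter_upwards [cubeQ_cover (n := n) L hL] with x hx using hsub hx
    have h1 : ENNReal.ofReal (∫ x, ‖f x‖ ^ 2) ≤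
        ENNReal.ofReal ((1 / 2 : ℝ) * ∫ x, ‖f x‖ ^ 2) + ENNReal.ofReal (∫ x in G, ‖f x‖ ^ 2) := by
      rw [← setIntegral_univ, hof Set.univ, ← setLIntegral_congr hae, hof G]
      refine (lintegral_union_le _ _ _).trans (add_le_add ?_ le_rfl)
      refine (lintegral_iUnion_le _ _).trans ?_
      simp_rw [← hof]
      rw [setIntegral_univ]
      exact hmain
    rw [← ENNReal.ofReal_add (by positivity) hJ0, ENNReal.ofReal_le_ofReal_iff (by positivity)] at h1
    linarith
end
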